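/- Let K be a field and S ⊆ A normal affine semigroups such that S is a pure subsemigroup of A (S = A ∩ gp(S) inside gp(A)). Let Ŝ = {z ∈ A : mz ∈ S for some integer m ≥ 1} be the integral closure of S in A, R = K[S] and Q = K[A]. For a coset z ∈ gp(Ŝ)/gp(S), let Q_z ⊆ Q be the K-span of the monomials of all elements of A whose residue class modulo gp(S) lies in the coset −z. Then every nonzero Q_z is a Cohen–Macaulay R-module. -/

import Mathlib

set_option synthInstance.maxHeartbeats 1000000
set_option maxHeartbeats 1000000

open scoped BigOperators

noncomputable section

/-- Pairing of an integral linear form (given by its coefficient vector `f`) with `x`. -/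
def lin {r : ℕ} (f x : Fin r → ℤ) : ℤ := ∑ k, f k * x k

lemma lin_zero {r : ℕ} (f : Fin r → ℤ) : lin f 0 = 0 := by simp [lin]

lemma lin_add {r : ℕ} (f x y : Fin r → ℤ) : lin f (x + y) = lin f x + lin f y := by
  simp [lin, mul_add, Finset.sum_add_distrib]

/-- A family of integral linear forms, bundled as an additive homomorphism `ℤ^r → ℤ^s`. -/
def formsHom {r s : ℕ} (σ : Fin s → Fin r → ℤ) : (Fin r → ℤ) →+ (Fin s → ℤ) where
  toFun x i := lin (σ i) x
  map_zero' := by funext i; simp [lin_zero]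
  map_add' x y := by funext i; simp [lin_add]

/-- The subgroup `σ(ℤ^r) ⊆ ℤ^s`. -/
def formsRange {r s : ℕ} (σ : Fin s → Fin r → ℤ) : AddSubgroup (Fin s → ℤ) :=
  (formsHom σ).range

/-- The divisor class group `Cl(R) = ℤ^s / σ(ℤ^r)`. -/
abbrev classGroup {r s : ℕ} (σ : Fin s → Fin r → ℤ) : Type :=
  (Fin s → ℤ) ⧸ formsRange σ

/-- The set of solutions of the inhomogeneous system of inequalities `σ_i(x) ≥ a_i`. -/
def Tset {r s : ℕ} (σ : Fin s → Fin r → ℤ) (a : Fin s → ℤ) : Set (Fin r → ℤ) :=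
  {x | ∀ i, a i ≤ lin (σ i) x}

/-- The monomial of exponent `x` in the group algebra `K[ℤ^r]`. -/
def mono (K : Type*) [Field K] {r : ℕ} (x : Fin r → ℤ) : AddMonoidAlgebra K (Fin r → ℤ) :=
  AddMonoidAlgebra.single x 1

/-- The affine semigroup ring `K[S]`, as a subalgebra of `K[ℤ^r]`. -/
def semigroupRing (K : Type*) [Field K] {r : ℕ} (S : AddSubmonoid (Fin r → ℤ)) :
    Subalgebra K (AddMonoidAlgebra K (Fin r → ℤ)) :=
  Algebra.adjoin K {f | ∃ x ∈ S, f = mono K x}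

/-- The monomial (fractional) ideal of `K[S]` with monomial basis `T ⊆ ℤ^r`, as a
`K[S]`-submodule of `K[ℤ^r]`.  (When `S + T ⊆ T`, its underlying set is the `K`-span
of the monomials with exponents in `T`.) -/
def monIdeal (K : Type*) [Field K] {r : ℕ} (S : AddSubmonoid (Fin r → ℤ))
    (T : Set (Fin r → ℤ)) :
    Submodule ↥(semigroupRing K S) (AddMonoidAlgebra K (Fin r → ℤ)) :=
  Submodule.span _ {f | ∃ x ∈ T, f = mono K x}

/-- The maximal ideal of `K[S]` generated by all nonunit monomials. -/
def irrelevantIdeal (K : Type*) [Field K] {r : ℕ} (S : AddSubmonoid (Fin r → ℤ)) :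
    Ideal ↥(semigroupRing K S) :=
  Ideal.span {f | ∃ x ∈ S, x ≠ 0 ∧ (f : AddMonoidAlgebra K (Fin r → ℤ)) = mono K x}

/-- `M` is a Cohen–Macaulay module with respect to the ideal `I ⊆ R`: the length of a
maximal `M`-regular sequence contained in `I` equals the Krull dimension of `M`
(the Krull dimension of `R/ann(M)`). -/
def IsCohenMacaulayMod (R : Type*) [CommRing R] (I : Ideal R)
    (M : Type*) [AddCommGroup M] [Module R M] : Prop :=
  ∃ rs : List R, (∀ x ∈ rs, x ∈ I) ∧ RingTheory.Sequence.IsRegular M rs ∧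
    (∀ y ∈ I, ¬ RingTheory.Sequence.IsRegular M (rs ++ [y])) ∧
    (rs.length : WithBot ℕ∞) = ringKrullDim (R ⧸ Module.annihilator R M)

open scoped Pointwise

section RelativeRegularity

variable (K : Type*) {R P : Type*} [Field K] [CommRing R] [Algebra K R] [AddCommGroup P]
  [Module R P] [Module K P] [IsScalarTower K R P]

/-- `rs` is a weakly regular sequence on `N ⧸ Z` whose quotient is finite dimensional over `K`, and
which is nonzero whenever `N ⧸ Z` is. -/
def FiniteRegular : List R → Submodule R P → Submodule R P → Prop
  | [], N, Z => ∃ F : Submodule K P, FiniteDimensional K F ∧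
      N.restrictScalars K ≤ F ⊔ Z.restrictScalars K
  | r :: rs, N, Z => (∀ f ∈ N, r • f ∈ Z → f ∈ Z) ∧ (N ≤ r • N ⊔ Z → N ≤ Z) ∧
      FiniteRegular rs N (r • N ⊔ Z)

variable {K}

lemma smul_le_self (r : R) (N : Submodule R P) : r • N ≤ N := by
  intro f hf
  obtain ⟨g, hg, rfl⟩ := (Submodule.mem_smul_pointwise_iff_exists _ _ _).1 hf
  exact N.smul_mem r hg

lemma FiniteRegular.sup {rs : List R} {N Z W : Submodule R P}
    (h : FiniteRegular K rs N W) (hW : W = N ⊓ Z) : FiniteRegular K rs (N ⊔ Z) Z := by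
  subst hW
  induction rs generalizing Z with
  | nil =>
    obtain ⟨F, hF, hle⟩ := h
    refine ⟨F, hF, ?_⟩
    intro x hx
    obtain ⟨n, hn, z, hz, rfl⟩ := Submodule.mem_sup.1 (show x ∈ N ⊔ Z from hx)
    obtain ⟨f, hf, g, hg, hfg⟩ := Submodule.mem_sup.1 (hle hn)
    refine Submodule.mem_sup.2 ⟨f, hf, g + z, Z.add_mem (show g ∈ N ⊓ Z from hg).2 hz, ?_⟩
    rw [← hfg, add_assoc]
  | cons r rs ih =>
    obtain ⟨h1, h2, h3⟩ := h
    have key : r • N ⊔ N ⊓ Z = N ⊓ (r • N ⊔ Z) := by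
      rw [inf_comm N (r • N ⊔ Z), sup_inf_assoc_of_le Z (smul_le_self r N), inf_comm]
    have key2 : r • (N ⊔ Z) ⊔ Z = r • N ⊔ Z := by
      rw [Submodule.smul_sup', sup_assoc, sup_eq_right.2 (smul_le_self r Z)]
    refine ⟨?_, ?_, ?_⟩
    · intro f hf hrf
      obtain ⟨n, hn, z, hz, rfl⟩ := Submodule.mem_sup.1 hf
      rw [smul_add] at hrf
      have hrn : r • n ∈ Z := (Z.add_mem_iff_left (Z.smul_mem r hz)).1 hrf
      exact Z.add_mem (h1 n hn ⟨N.smul_mem r hn, hrn⟩).2 hz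
    · intro hle
      rw [key2] at hle
      rw [key] at h2
      exact sup_le ((h2 (le_inf le_rfl (le_sup_left.trans hle))).trans inf_le_right) le_rfl
    · rw [key2]
      have := ih (Z := r • N ⊔ Z) (key ▸ h3)
      rwa [← sup_assoc, sup_eq_left.2 (smul_le_self r N)] at this

lemma FiniteRegular.trans {rs : List R} {N₁ N₂ N₃ : Submodule R P} (h12 : N₂ ≤ N₁) (h23 : N₃ ≤ N₂)
    (h : FiniteRegular K rs N₁ N₂) (h' : FiniteRegular K rs N₂ N₃) : FiniteRegular K rs N₁ N₃ := by
  induction rs generalizing N₁ N₂ N₃ with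
  | nil =>
    obtain ⟨F, hF, hle⟩ := h
    obtain ⟨F', hF', hle'⟩ := h'
    refine ⟨F ⊔ F', inferInstance, ?_⟩
    rw [sup_assoc]
    exact hle.trans (sup_le_sup_left hle' _)
  | cons r rs ih =>
    obtain ⟨a1, a2, a3⟩ := h
    obtain ⟨b1, b2, b3⟩ := h'
    refine ⟨fun f hf hrf => b1 f (a1 f hf (h23 hrf)) hrf, ?_, ?_⟩
    · intro hle
      have hN := a2 (hle.trans (sup_le_sup_left h23 _))
      obtain rfl := le_antisymm hN h12
      exact b2 hle
    · refine ih (N₂ := r • N₁ ⊔ N₂) (sup_le (smul_le_self r N₁) h12) (sup_le_sup_left h23 _) a3 ?_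
      have hW : r • N₂ ⊔ N₃ = N₂ ⊓ (r • N₁ ⊔ N₃) := by
        apply le_antisymm
        · exact sup_le (le_inf (smul_le_self r N₂)
            ((smul_mono_right r h12).trans le_sup_left)) (le_inf h23 le_sup_right)
        · rintro f ⟨hf, hf'⟩
          obtain ⟨x, hx, z, hz, rfl⟩ := Submodule.mem_sup.1 hf'
          obtain ⟨g, hg, rfl⟩ := (Submodule.mem_smul_pointwise_iff_exists _ _ _).1 hx
          have : r • g ∈ N₂ := (N₂.add_mem_iff_left (h23 hz)).1 hf
          exact Submodule.add_mem_sup (Submodule.smul_mem_pointwise_smul _ _ _ (a1 g hg this)) hz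
      have := b3.sup hW
      have e : N₂ ⊔ (r • N₁ ⊔ N₃) = r • N₁ ⊔ N₂ := by
        rw [sup_left_comm, sup_eq_left.2 h23]
      rwa [e] at this

lemma FiniteRegular.refl (rs : List R) (N : Submodule R P) : FiniteRegular K rs N N := by
  induction rs with
  | nil => exact ⟨⊥, inferInstance, le_sup_right⟩
  | cons r rs ih =>
    refine ⟨fun f hf _ => hf, fun _ => le_rfl, ?_⟩
    rwa [sup_eq_right.2 (smul_le_self r N)]

lemma FiniteRegular.of_chain {rs : List R} (N : ℕ → Submodule R P) (hN : ∀ a, N (a + 1) ≤ N a)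
    (h : ∀ a, FiniteRegular K rs (N a) (N (a + 1))) (n : ℕ) :
    FiniteRegular K rs (N 0) (N n) := by
  induction n with
  | zero => exact .refl _ _
  | succ n ih => exact ih.trans (antitone_nat_of_succ_le hN (Nat.zero_le n)) (hN n) (h n)

lemma FiniteRegular.regular {rs : List R} {N Z : Submodule R P} (h : FiniteRegular K rs N Z)
    (i : ℕ) (hi : i < rs.length) (f : P) (hf : f ∈ N)
    (hrf : rs[i] • f ∈ Ideal.ofList (rs.take i) • N ⊔ Z) :
    f ∈ Ideal.ofList (rs.take i) • N ⊔ Z := by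
  induction rs generalizing Z i with
  | nil => simp at hi
  | cons r rs ih =>
    cases i with
    | zero =>
      simp only [List.take_zero, Ideal.ofList_nil, Submodule.bot_smul, bot_sup_eq] at hrf ⊢
      exact h.1 f hf hrf
    | succ i =>
      have e : Ideal.ofList ((r :: rs).take (i + 1)) • N ⊔ Z =
          Ideal.ofList (rs.take i) • N ⊔ (r • N ⊔ Z) := by
        rw [List.take_succ_cons, Ideal.ofList_cons_smul, sup_assoc, sup_left_comm]
      rw [e] at hrf ⊢
      exact ih h.2.2 i (by simpa using hi) hrf

lemma FiniteRegular.le_of_le {rs : List R} {N Z : Submodule R P} (h : FiniteRegular K rs N Z)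
    (hle : N ≤ Ideal.ofList rs • N ⊔ Z) : N ≤ Z := by
  induction rs generalizing Z with
  | nil => simpa using hle
  | cons r rs ih =>
    rw [Ideal.ofList_cons_smul, sup_assoc, sup_left_comm] at hle
    exact h.2.1 (ih h.2.2 hle)

lemma FiniteRegular.exists_finite {rs : List R} {N Z : Submodule R P}
    (h : FiniteRegular K rs N Z) : ∃ F : Submodule K P, FiniteDimensional K F ∧
      N.restrictScalars K ≤ F ⊔ (Ideal.ofList rs • N ⊔ Z).restrictScalars K := by
  induction rs generalizing Z with
  | nil => simpa [FiniteRegular] using h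
  | cons r rs ih =>
    obtain ⟨F, hF, hle⟩ := ih h.2.2
    refine ⟨F, hF, ?_⟩
    rwa [Ideal.ofList_cons_smul, sup_assoc, sup_left_comm]

lemma coe_mem_ideal_smul_iff (I : Ideal R) (N : Submodule R P) (f : N) :
    (f : P) ∈ I • N ↔ f ∈ I • (⊤ : Submodule R N) := by
  have : I • N = (I • (⊤ : Submodule R N)).map N.subtype := by
    rw [Submodule.map_smul'', Submodule.map_top, Submodule.range_subtype]
  rw [this, Submodule.mem_map]
  exact ⟨fun ⟨g, hg, e⟩ => Subtype.ext e ▸ hg, fun h => ⟨f, h, rfl⟩⟩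

lemma FiniteRegular.isRegular {rs : List R} {N : Submodule R P} (h : FiniteRegular K rs N ⊥)
    (hN : N ≠ ⊥) : RingTheory.Sequence.IsRegular N rs where
  regular_mod_prev i hi := by
    rw [isSMulRegular_iff_right_eq_zero_of_smul]
    intro x hx
    obtain ⟨f, rfl⟩ := Submodule.Quotient.mk_surjective _ x
    rw [← Submodule.Quotient.mk_smul, Submodule.Quotient.mk_eq_zero,
      ← coe_mem_ideal_smul_iff] at hx
    rw [Submodule.Quotient.mk_eq_zero, ← coe_mem_ideal_smul_iff]
    simpa using h.regular i hi f f.2 (by simpa using hx)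
  top_ne_smul htop := by
    refine hN (le_bot_iff.1 (h.le_of_le fun f hf => ?_))
    rw [sup_bot_eq, show f = ((⟨f, hf⟩ : N) : P) from rfl, coe_mem_ideal_smul_iff, ← htop]
    trivial

lemma FiniteRegular.not_isRegular_append {rs : List R} {N : Submodule R P}
    (h : FiniteRegular K rs N ⊥) (y : R) : ¬ RingTheory.Sequence.IsRegular N (rs ++ [y]) := by
  intro hreg
  obtain ⟨F, hF, hle⟩ := h.exists_finite
  rw [sup_bot_eq] at hle
  set U : Submodule R N := Ideal.ofList rs • ⊤ with hU
  have hy : IsSMulRegular (N ⧸ U) y := by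
    have := hreg.regular_mod_prev rs.length (by simp)
    rwa [List.take_left, List.getElem_concat_length rfl] at this
  have hfin : FiniteDimensional K (N ⧸ U) := by
    let F' : Submodule K N := (F ⊔ (Ideal.ofList rs • N).restrictScalars K).comap
      (N.subtype.restrictScalars K)
    let V : Submodule K P := (Ideal.ofList rs • N).restrictScalars K
    have hinj : LinearMap.ker ((V.mkQ ∘ₗ N.subtype.restrictScalars K)) =
        U.restrictScalars K := by
      ext f
      simp only [LinearMap.mem_ker, LinearMap.comp_apply, Submodule.mkQ_apply,
        Submodule.Quotient.mk_eq_zero]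
      exact coe_mem_ideal_smul_iff _ _ _
    let φ : (N ⧸ U) →ₗ[K] (P ⧸ V) :=
      (Submodule.liftQ (U.restrictScalars K) (V.mkQ ∘ₗ N.subtype.restrictScalars K) hinj.ge)
    have hφ : Function.Injective φ := by
      rw [← LinearMap.ker_eq_bot]
      exact Submodule.ker_liftQ_eq_bot _ _ _ hinj.le
    have hφF : ∀ x, φ x ∈ F.map V.mkQ := by
      intro x
      obtain ⟨f, rfl⟩ := Submodule.Quotient.mk_surjective _ x
      obtain ⟨a, ha, b, hb, hab⟩ := Submodule.mem_sup.1 (hle f.2)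
      refine ⟨a, ha, ?_⟩
      change V.mkQ a = V.mkQ (f : P)
      rw [← hab, map_add, (Submodule.Quotient.mk_eq_zero V).2 hb |> fun e => (e : V.mkQ b = 0),
        add_zero]
    exact FiniteDimensional.of_injective (φ.codRestrict (F.map V.mkQ) hφF)
      (fun a b hab => hφ (congrArg Subtype.val hab))
  have hsurj : Function.Surjective fun x : N ⧸ U => y • x := by
    let μ : (N ⧸ U) →ₗ[K] (N ⧸ U) := (LinearMap.lsmul R (N ⧸ U) y).restrictScalars K
    exact LinearMap.injective_iff_surjective.1 (show Function.Injective μ from hy)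
  refine hreg.top_ne_smul (le_antisymm ?_ le_top)
  intro f _
  obtain ⟨x, hx⟩ := hsurj (Submodule.Quotient.mk f)
  obtain ⟨g, rfl⟩ := Submodule.Quotient.mk_surjective _ x
  have hx' : Submodule.Quotient.mk (p := U) (y • g) = Submodule.Quotient.mk f := hx
  rw [Submodule.Quotient.eq] at hx'
  have h1 : y • g ∈ Ideal.ofList (rs ++ [y]) • (⊤ : Submodule R N) :=
    Submodule.smul_mem_smul (Ideal.subset_span (by simp)) trivial
  have h2 : U ≤ Ideal.ofList (rs ++ [y]) • (⊤ : Submodule R N) :=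
    Submodule.smul_mono_left (Ideal.span_mono (by simp +contextual))
  simpa using Submodule.sub_mem _ h1 (h2 hx')

end RelativeRegularity

section MonomialModules

variable (K : Type*) [Field K] {m : ℕ} {S : AddSubmonoid (Fin m → ℤ)}

variable (S) in
/-- Being closed under translation by elements of `S`. -/
def StableUnder (Y : Set (Fin m → ℤ)) : Prop := ∀ s ∈ S, ∀ y ∈ Y, s + y ∈ Y

variable {K}

lemma exists_of_coeff_mul_ne_zero {f g : AddMonoidAlgebra K (Fin m → ℤ)} {x : Fin m → ℤ}
    (h : (f * g).coeff x ≠ 0) : ∃ a b, f.coeff a ≠ 0 ∧ g.coeff b ≠ 0 ∧ a + b = x := by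
  classical
  have := AddMonoidAlgebra.support_coeff_mul_subset f g (Finsupp.mem_support_iff.2 h)
  obtain ⟨a, ha, b, hb, e⟩ := Finset.mem_add.1 this
  exact ⟨a, b, Finsupp.mem_support_iff.1 ha, Finsupp.mem_support_iff.1 hb, e⟩

lemma eq_of_coeff_mono_ne_zero {x y : Fin m → ℤ} (h : (mono K x).coeff y ≠ 0) : x = y := by
  classical
  by_contra hxy
  exact h (by simp [mono, hxy])

lemma mem_semigroupRing {f : AddMonoidAlgebra K (Fin m → ℤ)} :
    f ∈ semigroupRing K S ↔ ∀ x, f.coeff x ≠ 0 → x ∈ S := by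
  classical
  constructor
  · intro hf
    refine Algebra.adjoin_induction (p := fun f _ => ∀ x, f.coeff x ≠ 0 → x ∈ S)
      ?_ ?_ ?_ ?_ hf
    · rintro _ ⟨x, hx, rfl⟩ y hy
      exact eq_of_coeff_mono_ne_zero hy ▸ hx
    · intro c x hx
      by_cases h0 : x = 0
      · exact h0 ▸ S.zero_mem
      · exact absurd (by simp [Ne.symm h0]) hx
    · intro f g _ _ hf hg x hx
      by_contra hxS
      exact hx (by simp [not_not.1 (mt (hf x) hxS), not_not.1 (mt (hg x) hxS)])
    · intro f g _ _ hf hg x hx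
      obtain ⟨a, b, ha, hb, rfl⟩ := exists_of_coeff_mul_ne_zero hx
      exact S.add_mem (hf a ha) (hg b hb)
  · intro h
    have := AddMonoidAlgebra.mem_span_support_coeff f
    refine (Submodule.span_le (p := Subalgebra.toSubmodule (semigroupRing K S))).2 ?_ this
    rintro _ ⟨x, hx, rfl⟩
    exact Algebra.subset_adjoin ⟨x, h x (Finsupp.mem_support_iff.1 hx), rfl⟩

lemma smul_def_coe (r : semigroupRing K S) (f : AddMonoidAlgebra K (Fin m → ℤ)) :
    r • f = (r : AddMonoidAlgebra K (Fin m → ℤ)) * f := rfl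

lemma mem_monIdeal {Y : Set (Fin m → ℤ)} (hY : StableUnder S Y)
    {f : AddMonoidAlgebra K (Fin m → ℤ)} :
    f ∈ monIdeal K S Y ↔ ∀ x, f.coeff x ≠ 0 → x ∈ Y := by
  classical
  constructor
  · intro hf
    refine Submodule.span_induction (p := fun f _ => ∀ x, f.coeff x ≠ 0 → x ∈ Y) ?_ ?_ ?_ ?_ hf
    · rintro _ ⟨x, hx, rfl⟩ y hy
      exact eq_of_coeff_mono_ne_zero hy ▸ hx
    · intro x hx
      simp at hx
    · intro f g _ _ hf hg x hx
      by_contra hxS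
      exact hx (by simp [not_not.1 (mt (hf x) hxS), not_not.1 (mt (hg x) hxS)])
    · intro r f _ hf x hx
      obtain ⟨a, b, ha, hb, rfl⟩ := exists_of_coeff_mul_ne_zero hx
      exact hY a (mem_semigroupRing.1 r.2 a ha) b (hf b hb)
  · intro h
    have := AddMonoidAlgebra.mem_span_support_coeff f
    refine (Submodule.span_le (p := (monIdeal K S Y).restrictScalars K)).2 ?_ this
    rintro _ ⟨x, hx, rfl⟩
    exact Submodule.subset_span ⟨x, h x (Finsupp.mem_support_iff.1 hx), rfl⟩

lemma monIdeal_mono {Y Z : Set (Fin m → ℤ)} (h : Y ⊆ Z) : monIdeal K S Y ≤ monIdeal K S Z :=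
  Submodule.span_mono fun _ ⟨x, hx, e⟩ => ⟨x, h hx, e⟩

lemma monIdeal_empty : monIdeal K S ∅ = ⊥ := by simp [monIdeal]

/-- The monomial with exponent in `S`, as an element of the semigroup ring. -/
def ringMono (x : S) : semigroupRing K S :=
  ⟨mono K x, Algebra.subset_adjoin ⟨x, x.2, rfl⟩⟩

lemma coe_ringMono (x : S) :
    (ringMono x : semigroupRing K S) = (mono K (x : Fin m → ℤ) : AddMonoidAlgebra K _) := rfl

lemma coeff_mono_mul (v x : Fin m → ℤ) (f : AddMonoidAlgebra K (Fin m → ℤ)) :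
    (mono K v * f).coeff x = f.coeff (x - v) := by
  rw [mono, AddMonoidAlgebra.coeff_single_mul_apply, one_mul, neg_add_eq_sub]

lemma coeff_ringMono_smul (v : S) (x : Fin m → ℤ) (f : AddMonoidAlgebra K (Fin m → ℤ)) :
    ((ringMono v : semigroupRing K S) • f).coeff x = f.coeff (x - v) :=
  coeff_mono_mul _ _ _

end MonomialModules

section MonomialStep

variable {K : Type*} [Field K] {m : ℕ} {S : AddSubmonoid (Fin m → ℤ)}

lemma smul_mem_monIdeal_of_maps {Y Z : Set (Fin m → ℤ)} (hY : StableUnder S Y)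
    (hZ : StableUnder S Z) (u : S) (hu : ∀ y ∈ Y, (u : Fin m → ℤ) + y ∈ Z)
    {f : AddMonoidAlgebra K (Fin m → ℤ)} (hf : f ∈ monIdeal K S Y) :
    (ringMono u : semigroupRing K S) • f ∈ monIdeal K S Z := by
  rw [mem_monIdeal hY] at hf
  rw [mem_monIdeal hZ]
  intro x hx
  rw [coeff_ringMono_smul] at hx
  simpa using hu _ (hf _ hx)

/-- If `θ` acts on a quotient of monomial modules as a single monomial, then regularity of `θ` can
be read off from the sets of exponents. -/
lemma FiniteRegular.cons_of_acts_as_mono {Y Z : Set (Fin m → ℤ)} (hY : StableUnder S Y)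
    (hZ : StableUnder S Z) (v : S) (θ : semigroupRing K S)
    (hθ : ∀ f ∈ monIdeal K S Y, (θ - ringMono v) • f ∈ monIdeal K S Z)
    (hreg : ∀ x ∈ Y, (v : Fin m → ℤ) + x ∈ Z → x ∈ Z)
    (hnt : (∀ x ∈ Y, x - (v : Fin m → ℤ) ∈ Y ∨ x ∈ Z) → Y ⊆ Z)
    {rs : List (semigroupRing K S)}
    (h : FiniteRegular K rs (monIdeal K S Y)
      (monIdeal K S ({x | x - (v : Fin m → ℤ) ∈ Y} ∪ Z))) :
    FiniteRegular K (θ :: rs) (monIdeal K S Y) (monIdeal K S Z) := by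
  have hU : StableUnder S ({x | x - (v : Fin m → ℤ) ∈ Y} ∪ Z) := by
    rintro s hs y (hy | hy)
    · left
      have := hY s hs _ hy
      rwa [← add_sub_assoc] at this
    · exact Or.inr (hZ s hs y hy)
  have hdec : ∀ f : AddMonoidAlgebra K (Fin m → ℤ),
      θ • f = (ringMono v : semigroupRing K S) • f + (θ - ringMono v) • f := by
    intro f
    rw [sub_smul, add_sub_cancel]
  have key : θ • monIdeal K S Y ⊔ monIdeal K S Z =
      monIdeal K S ({x | x - (v : Fin m → ℤ) ∈ Y} ∪ Z) := by
    apply le_antisymm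
    · refine sup_le ?_ (monIdeal_mono Set.subset_union_right)
      intro g hg
      obtain ⟨f, hf, rfl⟩ := (Submodule.mem_smul_pointwise_iff_exists _ _ _).1 hg
      rw [hdec]
      refine Submodule.add_mem _ ?_ (monIdeal_mono Set.subset_union_right (hθ f hf))
      refine smul_mem_monIdeal_of_maps hY hU v (fun y hy => Or.inl ?_) hf
      simpa using hy
    · refine Submodule.span_le.2 ?_
      rintro _ ⟨x, hx | hx, rfl⟩
      · have h1 : mono K (x - (v : Fin m → ℤ)) ∈ monIdeal K S Y :=
          Submodule.subset_span ⟨_, hx, rfl⟩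
        have h2 := hdec (mono K (x - (v : Fin m → ℤ)))
        have h3 : (ringMono v : semigroupRing K S) • mono K (x - (v : Fin m → ℤ)) = mono K x := by
          rw [smul_def_coe, coe_ringMono, mono, mono, AddMonoidAlgebra.single_mul_single]
          simp [mono]
        rw [h3] at h2
        rw [eq_sub_of_add_eq h2.symm]
        exact Submodule.sub_mem _
          (Submodule.mem_sup_left (Submodule.smul_mem_pointwise_smul _ _ _ h1))
          (Submodule.mem_sup_right (hθ _ h1))
      · exact Submodule.mem_sup_right (Submodule.subset_span ⟨x, hx, rfl⟩)
  refine ⟨?_, ?_, (congrArg (FiniteRegular K rs (monIdeal K S Y)) key).mpr h⟩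
  · intro f hf hθf
    have h1 : (ringMono v : semigroupRing K S) • f ∈ monIdeal K S Z := by
      have := Submodule.sub_mem _ hθf (hθ f hf)
      rwa [hdec, add_sub_cancel_right] at this
    rw [mem_monIdeal hZ] at h1 ⊢
    rw [mem_monIdeal hY] at hf
    intro x hx
    refine hreg x (hf x hx) (h1 _ ?_)
    rwa [coeff_ringMono_smul, add_sub_cancel_left]
  · intro hle
    replace hle := hle.trans key.le
    refine monIdeal_mono (hnt fun x hx => ?_)
    have := (mem_monIdeal hU).1 (hle (Submodule.subset_span ⟨x, hx, rfl⟩)) x (by simp [mono])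
    exact this

end MonomialStep

section UnitDirections

variable {K : Type*} [Field K] {m : ℕ} {S : AddSubmonoid (Fin m → ℤ)}

/-- The sum of the coefficients of `f` with exponent in `C`. -/
def coeffSum (C : Set (Fin m → ℤ)) : AddMonoidAlgebra K (Fin m → ℤ) →+ K :=
  (Finsupp.linearCombination K (C.indicator (1 : (Fin m → ℤ) → K))).toAddMonoidHom.comp
    AddMonoidAlgebra.coeffAddEquiv.toAddMonoidHom

lemma coeffSum_single (C : Set (Fin m → ℤ)) (x : Fin m → ℤ) (c : K) :
    coeffSum C (AddMonoidAlgebra.single x c) = c * C.indicator 1 x := by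
  simp [coeffSum]

lemma coeffSum_eq_zero {C : Set (Fin m → ℤ)} {f : AddMonoidAlgebra K (Fin m → ℤ)}
    (h : ∀ x, f.coeff x ≠ 0 → x ∉ C) : coeffSum C f = 0 := by
  simp only [coeffSum, AddMonoidHom.comp_apply]
  change Finsupp.linearCombination K _ f.coeff = 0
  rw [Finsupp.linearCombination_apply]
  refine Finset.sum_eq_zero fun x hx => ?_
  simp [h x (Finsupp.mem_support_iff.1 hx)]

lemma coeffSum_single_mul (C : Set (Fin m → ℤ)) (v : Fin m → ℤ) (c : K)
    (f : AddMonoidAlgebra K (Fin m → ℤ)) :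
    coeffSum C (AddMonoidAlgebra.single v c * f) = c * coeffSum {x | v + x ∈ C} f := by
  induction f using AddMonoidAlgebra.induction_linear with
  | zero => simp
  | add f g hf hg => rw [mul_add, map_add, hf, hg, map_add, mul_add]
  | single x d =>
    rw [AddMonoidAlgebra.single_mul_single, coeffSum_single, coeffSum_single, mul_assoc]
    rfl

variable (K S) in
/-- The submodule generated by the monomials with exponent in `Z` and the differences of monomials
with exponents in `Y \ Z` that are congruent modulo `H`. -/
def congrSubmodule (Y Z : Set (Fin m → ℤ)) (H : AddSubgroup (Fin m → ℤ)) :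
    Submodule (semigroupRing K S) (AddMonoidAlgebra K (Fin m → ℤ)) :=
  Submodule.span _ {f | ∃ a b, a ∈ Y \ Z ∧ b ∈ Y \ Z ∧ a - b ∈ H ∧ f = mono K a - mono K b} ⊔
    monIdeal K S Z

variable {Y Z : Set (Fin m → ℤ)}

lemma mono_sub_mono_mem {H : AddSubgroup (Fin m → ℤ)} {a b : Fin m → ℤ} (ha : a ∈ Y \ Z)
    (hb : b ∈ Y \ Z) (hab : a - b ∈ H) : mono K a - mono K b ∈ congrSubmodule K S Y Z H :=
  Submodule.mem_sup_left (Submodule.subset_span ⟨a, b, ha, hb, hab, rfl⟩)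

lemma congrSubmodule_le (hZY : Z ⊆ Y) (H : AddSubgroup (Fin m → ℤ)) :
    congrSubmodule K S Y Z H ≤ monIdeal K S Y := by
  refine sup_le (Submodule.span_le.2 ?_) (monIdeal_mono hZY)
  rintro _ ⟨a, b, ha, hb, -, rfl⟩
  exact Submodule.sub_mem _ (Submodule.subset_span ⟨a, ha.1, rfl⟩)
    (Submodule.subset_span ⟨b, hb.1, rfl⟩)

lemma congrSubmodule_bot : congrSubmodule K S Y Z ⊥ = monIdeal K S Z := by
  refine sup_eq_right.2 (Submodule.span_le.2 ?_)
  rintro _ ⟨a, b, -, -, hab, rfl⟩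
  rw [AddSubgroup.mem_bot, sub_eq_zero] at hab
  simp [hab]

lemma StableUnder.add_mem_diff (hY : StableUnder S Y) (hZ : StableUnder S Z)
    {h x : Fin m → ℤ} (h1 : h ∈ S) (h2 : -h ∈ S) (hx : x ∈ Y \ Z) : h + x ∈ Y \ Z :=
  ⟨hY h h1 x hx.1, fun hz => hx.2 (by simpa using hZ _ h2 _ hz)⟩

lemma coeffSum_eq_zero_of_mem_congrSubmodule (hY : StableUnder S Y) (hZ : StableUnder S Z)
    (hZY : Z ⊆ Y) {H : AddSubgroup (Fin m → ℤ)} (hH : ∀ h ∈ H, h ∈ S)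
    {f : AddMonoidAlgebra K (Fin m → ℤ)} (hf : f ∈ congrSubmodule K S Y Z H)
    {c : Fin m → ℤ} (hc : c ∈ Y \ Z) : coeffSum {x | x - c ∈ H} f = 0 := by
  let V : Submodule (semigroupRing K S) (AddMonoidAlgebra K (Fin m → ℤ)) :=
    { carrier := {f | f ∈ monIdeal K S Y ∧ ∀ c ∈ Y \ Z, coeffSum {x | x - c ∈ H} f = 0}
      add_mem' := by
        rintro f g ⟨hf, hf'⟩ ⟨hg, hg'⟩
        exact ⟨add_mem hf hg, fun c hc => by rw [map_add, hf' c hc, hg' c hc, add_zero]⟩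
      zero_mem' := ⟨zero_mem _, fun c _ => map_zero _⟩
      smul_mem' := by
        rintro ⟨r, hr⟩ f ⟨hf, hf'⟩
        refine ⟨Submodule.smul_mem _ _ hf, fun c hc => ?_⟩
        change coeffSum _ (r * f) = 0
        rw [mem_semigroupRing] at hr
        have hsum : r = r.coeff.sum AddMonoidAlgebra.single := by
          exact (AddMonoidAlgebra.sum_coeff_single r).symm
        rw [hsum, Finsupp.sum, Finset.sum_mul, map_sum]
        refine Finset.sum_eq_zero fun s hs => ?_
        have hsS := hr s (Finsupp.mem_support_iff.1 hs)
        rw [coeffSum_single_mul]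
        have e : {x | s + x ∈ {x | x - c ∈ H}} = {x | x - (c - s) ∈ H} := by
          ext x
          simp [sub_sub_eq_add_sub, add_comm]
        rw [e]
        by_cases hcs : c - s ∈ Y \ Z
        · rw [hf' _ hcs, mul_zero]
        · rw [coeffSum_eq_zero, mul_zero]
          intro x hx hxH
          have hxY := (mem_monIdeal hY).1 hf x hx
          rw [Set.mem_ofPred_eq] at hxH
          have hxZ : x ∉ Z := by
            intro hxZ
            have := hZ _ (hH _ (H.neg_mem hxH)) _ (hZ s hsS x hxZ)
            refine hc.2 ?_
            convert this using 1
            abel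
          refine hcs ?_
          have := hY.add_mem_diff hZ (hH _ (H.neg_mem hxH)) (by simpa using hH _ hxH)
            (x := x) ⟨hxY, hxZ⟩
          simpa using this }
  refine (show congrSubmodule K S Y Z H ≤ V from sup_le ?_ ?_) hf |>.2 c hc
  · rw [Submodule.span_le]
    rintro _ ⟨a, b, ha, hb, hab, rfl⟩
    refine ⟨congrSubmodule_le (K := K) hZY H (mono_sub_mono_mem ha hb hab), fun c hc => ?_⟩
    rw [map_sub, mono, mono, coeffSum_single, coeffSum_single]
    have : a ∈ {x | x - c ∈ H} ↔ b ∈ {x | x - c ∈ H} := by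
      rw [Set.mem_ofPred_eq, Set.mem_ofPred_eq, ← sub_add_sub_cancel a b c]
      exact H.add_mem_cancel_left hab
    by_cases hb : b ∈ {x | x - c ∈ H}
    · rw [Set.indicator_of_mem hb, Set.indicator_of_mem (this.2 hb)]; simp
    · rw [Set.indicator_of_notMem hb, Set.indicator_of_notMem (mt this.1 hb)]; simp
  · intro f hf
    refine ⟨monIdeal_mono hZY hf, fun c hc => coeffSum_eq_zero fun x hx hxc => hc.2 ?_⟩
    have := hZ _ (hH _ (H.neg_mem hxc)) _ ((mem_monIdeal hZ).1 hf x hx)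
    simpa using this

lemma mem_congrSubmodule_of_coeffSum (hY : StableUnder S Y) 
    {H : AddSubgroup (Fin m → ℤ)} (hH : ∀ h ∈ H, ∀ x ∈ Y \ Z, h + x ∈ Y \ Z)
    {f : AddMonoidAlgebra K (Fin m → ℤ)} (hf : f ∈ monIdeal K S Y)
    (h0 : ∀ c ∈ Y \ Z, coeffSum {x | x - c ∈ H} f = 0) : f ∈ congrSubmodule K S Y Z H := by
  classical
  rw [mem_monIdeal hY] at hf
  let ρ : (Fin m → ℤ) → (Fin m → ℤ) := fun x =>
    if x ∈ Y \ Z then ((x : (Fin m → ℤ) ⧸ H)).out else x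
  have hρ1 : ∀ x, ρ x - x ∈ H := by
    intro x
    by_cases hx : x ∈ Y \ Z
    · simp only [ρ, if_pos hx]
      rw [← neg_mem_iff, neg_sub, sub_eq_neg_add, ← QuotientAddGroup.eq]
      exact Quotient.out_eq _
    · simp only [ρ, if_neg hx, sub_self, H.zero_mem]
  have hρ2 : ∀ x, x ∈ Y \ Z → ρ x ∈ Y \ Z := fun x hx => by
    simpa using hH _ (hρ1 x) x hx
  have hρ3 : ∀ x y, x ∈ Y \ Z → y ∈ Y \ Z → x - y ∈ H → ρ x = ρ y := by
    intro x y hx hy hxy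
    simp only [ρ, if_pos hx, if_pos hy]
    congr 1
    rw [← neg_mem_iff, neg_sub, sub_eq_neg_add, ← QuotientAddGroup.eq] at hxy
    exact hxy
  have hsum : f = ∑ x ∈ f.coeff.support, AddMonoidAlgebra.single x (f.coeff x) := by
    exact (AddMonoidAlgebra.sum_coeff_single f).symm
  have hsplit : f = (∑ x ∈ f.coeff.support, (AddMonoidAlgebra.single x (f.coeff x) -
      AddMonoidAlgebra.single (ρ x) (f.coeff x))) +
      ∑ x ∈ f.coeff.support, AddMonoidAlgebra.single (ρ x) (f.coeff x) := by
    rw [Finset.sum_sub_distrib, sub_add_cancel]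
    exact hsum
  rw [hsplit]
  have hsingle : ∀ (x : Fin m → ℤ) (c : K), AddMonoidAlgebra.single x c = c • mono K x := by
    intro x c; simp [mono]
  refine add_mem (sum_mem fun x hx => ?_) ?_
  · rw [hsingle, hsingle, ← smul_sub]
    by_cases hxX : x ∈ Y \ Z
    · refine Submodule.smul_of_tower_mem _ _ (mono_sub_mono_mem hxX (hρ2 x hxX) ?_)
      rw [← neg_mem_iff, neg_sub]
      exact hρ1 x
    · simp only [ρ, if_neg hxX, sub_self, smul_zero, zero_mem]
  · have key : ∀ c, c ∉ Z →
        (∑ x ∈ f.coeff.support, AddMonoidAlgebra.single (ρ x) (f.coeff x)).coeff c = 0 := by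
      intro c hcZ
      by_cases hcρ : ∃ x ∈ f.coeff.support, ρ x = c
      · obtain ⟨y, hy, rfl⟩ := hcρ
        have hyX : y ∈ Y \ Z := by
          by_contra hyX
          have : ρ y = y := by simp only [ρ, if_neg hyX]
          rw [this] at hcZ
          exact hyX ⟨hf y (Finsupp.mem_support_iff.1 hy), hcZ⟩
        rw [← h0 _ (hρ2 y hyX)]
        conv_rhs => rw [hsum, map_sum]
        rw [AddMonoidAlgebra.coeff_sum, Finsupp.finsetSum_apply]
        refine Finset.sum_congr rfl fun x hx => ?_
        rw [coeffSum_single, AddMonoidAlgebra.coeff_single, Finsupp.single_apply]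
        have hiff : ρ x = ρ y ↔ x ∈ {x | x - ρ y ∈ H} := by
          constructor
          · intro hxy
            rw [Set.mem_ofPred_eq, ← hxy, ← neg_mem_iff, neg_sub]
            exact hρ1 x
          · intro hxy
            have hxX : x ∈ Y \ Z := by
              simpa using hH _ hxy _ (hρ2 y hyX)
            refine hρ3 x y hxX hyX ?_
            have := H.add_mem hxy (hρ1 y)
            simpa using this
        by_cases hxy : ρ x = ρ y
        · rw [if_pos hxy, Set.indicator_of_mem (hiff.1 hxy)]; simp
        · rw [if_neg hxy, Set.indicator_of_notMem (mt hiff.2 hxy)]; simp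
      · push Not at hcρ
        rw [AddMonoidAlgebra.coeff_sum, Finsupp.finsetSum_apply]
        exact Finset.sum_eq_zero fun x hx => by
          rw [AddMonoidAlgebra.coeff_single, Finsupp.single_apply, if_neg (hcρ x hx)]
    refine Submodule.mem_sup_right ?_
    have := AddMonoidAlgebra.mem_span_support_coeff
      (∑ x ∈ f.coeff.support, AddMonoidAlgebra.single (ρ x) (f.coeff x))
    refine (Submodule.span_le (p := (monIdeal K S Z).restrictScalars K)).2 ?_ this
    rintro _ ⟨x, hx, rfl⟩
    exact Submodule.subset_span ⟨x, by_contra fun h => Finsupp.mem_support_iff.1 hx (key x h), rfl⟩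

end UnitDirections

section UnitSequence

variable {K : Type*} [Field K] {m : ℕ} {S : AddSubmonoid (Fin m → ℤ)} {Y Z : Set (Fin m → ℤ)}

lemma zmultiples_sup_le {H : AddSubgroup (Fin m → ℤ)} {e x : Fin m → ℤ}
    (hx : x ∈ H ⊔ AddSubgroup.zmultiples e) : ∃ h ∈ H, ∃ n : ℤ, h + n • e = x := by
  obtain ⟨h, hh, y, hy, rfl⟩ := AddSubgroup.mem_sup.1 hx
  obtain ⟨n, rfl⟩ := AddSubgroup.mem_zmultiples_iff.1 hy
  exact ⟨h, hh, n, rfl⟩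

lemma FiniteRegular.cons_unit (hY : StableUnder S Y) (hZ : StableUnder S Z) (hZY : Z ⊆ Y)
    {H : AddSubgroup (Fin m → ℤ)} (e : S)
    (hH : ∀ h ∈ H ⊔ AddSubgroup.zmultiples (e : Fin m → ℤ), h ∈ S)
    (he : ∀ n : ℕ, n • (e : Fin m → ℤ) ∈ H → n = 0) {rs : List (semigroupRing K S)}
    (h : FiniteRegular K rs (monIdeal K S Y)
      (congrSubmodule K S Y Z (H ⊔ AddSubgroup.zmultiples (e : Fin m → ℤ)))) :
    FiniteRegular K ((ringMono e - 1) :: rs) (monIdeal K S Y) (congrSubmodule K S Y Z H) := by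
  set H' := H ⊔ AddSubgroup.zmultiples (e : Fin m → ℤ) with hH'
  have hHS : ∀ h ∈ H, h ∈ S := fun h hh => hH h (AddSubgroup.mem_sup_left hh)
  have heH' : (e : Fin m → ℤ) ∈ H' :=
    AddSubgroup.mem_sup_right (AddSubgroup.mem_zmultiples _)
  have hX : ∀ h ∈ H', ∀ x ∈ Y \ Z, h + x ∈ Y \ Z := fun h hh x hx =>
    hY.add_mem_diff hZ (hH h hh) (hH _ (neg_mem hh)) hx
  have hact : ∀ x, ((ringMono e - 1 : semigroupRing K S)) • mono K x =
      mono K ((e : Fin m → ℤ) + x) - mono K x := by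
    intro x
    rw [sub_smul, one_smul, smul_def_coe, coe_ringMono, mono, mono,
      AddMonoidAlgebra.single_mul_single, one_mul]
    rfl
  have hle : congrSubmodule K S Y Z H ≤ congrSubmodule K S Y Z H' := by
    refine sup_le_sup_right (Submodule.span_mono ?_) _
    rintro _ ⟨a, b, ha, hb, hab, rfl⟩
    exact ⟨a, b, ha, hb, AddSubgroup.mem_sup_left hab, rfl⟩
  have key : (ringMono e - 1 : semigroupRing K S) • monIdeal K S Y ⊔ congrSubmodule K S Y Z H =
      congrSubmodule K S Y Z H' := by
    apply le_antisymm
    · refine sup_le ?_ hle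
      suffices monIdeal K S Y ≤ (congrSubmodule K S Y Z H').comap
          (LinearMap.lsmul _ _ (ringMono e - 1 : semigroupRing K S)) by
        intro g hg
        obtain ⟨f, hf, rfl⟩ := (Submodule.mem_smul_pointwise_iff_exists _ _ _).1 hg
        exact this hf
      refine Submodule.span_le.2 ?_
      rintro _ ⟨x, hx, rfl⟩
      rw [SetLike.mem_coe, Submodule.mem_comap]
      change (ringMono e - 1 : semigroupRing K S) • mono K x ∈ congrSubmodule K S Y Z H'
      rw [hact]
      by_cases hxZ : x ∈ Z
      · exact Submodule.mem_sup_right (sub_mem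
          (Submodule.subset_span ⟨_, hZ _ e.2 _ hxZ, rfl⟩) (Submodule.subset_span ⟨x, hxZ, rfl⟩))
      · exact mono_sub_mono_mem (hX _ heH' _ ⟨hx, hxZ⟩) ⟨hx, hxZ⟩ (by simpa using heH')
    · refine sup_le ?_ (le_sup_of_le_right le_sup_right)
      rw [Submodule.span_le]
      rintro _ ⟨a, b, ha, hb, hab, rfl⟩
      obtain ⟨h, hh, n, hn⟩ := zmultiples_sup_le hab
      have hnb : ∀ n : ℤ, n • (e : Fin m → ℤ) + b ∈ Y \ Z := fun n =>
        hX _ (AddSubgroup.zsmul_mem _ heH' n) _ hb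
      have hstep : ∀ n : ℤ, mono K (n • (e : Fin m → ℤ) + b) - mono K b ∈
          (ringMono e - 1 : semigroupRing K S) • monIdeal K S Y ⊔ congrSubmodule K S Y Z H := by
        have hone : ∀ n : ℤ, mono K ((n + 1) • (e : Fin m → ℤ) + b) -
            mono K (n • (e : Fin m → ℤ) + b) ∈
          (ringMono e - 1 : semigroupRing K S) • monIdeal K S Y ⊔ congrSubmodule K S Y Z H := by
          intro n
          refine Submodule.mem_sup_left ?_
          have : (n + 1) • (e : Fin m → ℤ) + b = e + (n • (e : Fin m → ℤ) + b) := by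
            rw [add_smul, one_smul]; abel
          rw [this, ← hact]
          exact Submodule.smul_mem_pointwise_smul _ _ _
            (Submodule.subset_span ⟨_, (hnb n).1, rfl⟩)
        intro n
        induction n using Int.induction_on with
        | zero => simp
        | succ n ih =>
          have := add_mem (hone n) ih
          simpa using this
        | pred n ih =>
          have := sub_mem ih (hone (-n - 1))
          simpa using this
      have hd : mono K a - mono K b = (mono K a - mono K (n • (e : Fin m → ℤ) + b)) +
          (mono K (n • (e : Fin m → ℤ) + b) - mono K b) := by abel
      rw [hd]
      refine add_mem (Submodule.mem_sup_right (mono_sub_mono_mem ha (hnb n) ?_)) (hstep n)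
      rw [show a - (n • (e : Fin m → ℤ) + b) = h by rw [← sub_sub, sub_right_comm, ← hn]; abel]
      exact hh
  refine ⟨?_, ?_, (congrArg (FiniteRegular K rs (monIdeal K S Y)) key).mpr h⟩
  · intro f hf hef
    refine mem_congrSubmodule_of_coeffSum hY
      (fun h hh => hX h (AddSubgroup.mem_sup_left hh)) hf fun c hc => ?_
    have hshift : ∀ c ∈ Y \ Z, coeffSum {x | x - ((-(e : Fin m → ℤ)) + c) ∈ H} f =
        coeffSum {x | x - c ∈ H} f := by
      intro c hc
      have h1 := coeffSum_eq_zero_of_mem_congrSubmodule hY hZ hZY hHS hef hc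
      rw [sub_smul, one_smul, map_sub, sub_eq_zero, smul_def_coe, coe_ringMono, mono,
        coeffSum_single_mul, one_mul] at h1
      rw [← h1]
      congr 2
      ext x
      rw [Set.mem_ofPred_eq, Set.mem_ofPred_eq, Set.mem_ofPred_eq]
      rw [show x - (-(e : Fin m → ℤ) + c) = e + x - c by abel]
    have hshift' : ∀ n : ℕ, coeffSum {x | x - (n • (-(e : Fin m → ℤ)) + c) ∈ H} f =
        coeffSum {x | x - c ∈ H} f := by
      intro n
      induction n with
      | zero => simp
      | succ n ih =>
        rw [← ih, ← hshift _ (hX _ (AddSubgroup.nsmul_mem _ (neg_mem heH') n) _ hc),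
          ← add_assoc, add_smul, one_smul, add_comm (n • -(e : Fin m → ℤ))]
    by_contra hne
    have hex : ∀ n : ℕ, ∃ x ∈ f.coeff.support, x - (n • (-(e : Fin m → ℤ)) + c) ∈ H := by
      intro n
      by_contra hno
      push Not at hno
      refine hne ((hshift' n).symm.trans (coeffSum_eq_zero fun x hx => ?_))
      exact hno x (Finsupp.mem_support_iff.2 hx)
    choose g hg hgH using hex
    obtain ⟨n, -, k, -, hnk, hgnk⟩ :=
      Set.infinite_univ.exists_ne_map_eq_of_mapsTo (f := g)
        (t := (f.coeff.support : Set (Fin m → ℤ))) (fun n _ => hg n) (Finset.finite_toSet _)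
    wlog hlt : n < k generalizing n k
    · exact this k n hnk.symm hgnk.symm (lt_of_le_of_ne (not_lt.1 hlt) hnk.symm)
    have h1 := H.sub_mem (hgH k) (hgH n)
    rw [hgnk] at h1
    have h2 : (k - n) • (e : Fin m → ℤ) ∈ H := by
      convert h1 using 1
      obtain ⟨d, rfl⟩ := Nat.exists_eq_add_of_lt hlt
      rw [show n + d + 1 - n = d + 1 by omega, add_assoc, add_smul n]
      simp only [smul_neg]
      abel
    have := he _ h2
    omega
  · intro hle'
    replace hle' := hle'.trans key.le
    have hYZ : Y ⊆ Z := by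
      intro x hx
      by_contra hxZ
      have h1 := coeffSum_eq_zero_of_mem_congrSubmodule hY hZ hZY hH
        (hle' (Submodule.subset_span ⟨x, hx, rfl⟩)) ⟨hx, hxZ⟩
      rw [mono, coeffSum_single] at h1
      simp at h1
    exact (monIdeal_mono hYZ).trans le_sup_right

lemma FiniteRegular.of_units (hY : StableUnder S Y) (hZ : StableUnder S Z) (hZY : Z ⊆ Y)
    {n : ℕ} (e : Fin n → S) (hS : ∀ i, -(e i : Fin m → ℤ) ∈ S)
    (hli : LinearIndependent ℤ fun i => (e i : Fin m → ℤ))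
    (hX : ∀ x ∈ Y \ Z, ∀ y ∈ Y \ Z,
      x - y ∈ Submodule.span ℤ (Set.range fun i => (e i : Fin m → ℤ))) :
    FiniteRegular K (List.ofFn fun i => ringMono (e i) - 1) (monIdeal K S Y)
      (monIdeal K S Z) := by
  have hspan : ∀ s : Set (Fin n), ∀ x ∈ Submodule.span ℤ ((fun i => (e i : Fin m → ℤ)) '' s),
      x ∈ S := by
    intro s x hx
    refine Submodule.span_induction (p := fun x _ => x ∈ S ∧ -x ∈ S) ?_ ?_ ?_ ?_ hx |>.1
    · rintro _ ⟨i, -, rfl⟩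
      exact ⟨(e i).2, hS i⟩
    · simp
    · rintro x y - - ⟨h1, h2⟩ ⟨h3, h4⟩
      exact ⟨add_mem h1 h3, by rw [neg_add]; exact add_mem h2 h4⟩
    · rintro a x - ⟨h1, h2⟩
      obtain ⟨k, rfl | rfl⟩ := a.eq_nat_or_neg
      · rw [natCast_zsmul, ← smul_neg]
        exact ⟨nsmul_mem h1 k, nsmul_mem h2 k⟩
      · rw [neg_smul, natCast_zsmul, neg_neg, ← smul_neg]
        exact ⟨nsmul_mem h2 k, nsmul_mem h1 k⟩
  suffices H : ∀ k (hk : k ≤ n), FiniteRegular K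
      ((List.ofFn fun i => (ringMono (e i) - 1 : semigroupRing K S)).drop k) (monIdeal K S Y)
      (congrSubmodule K S Y Z (Submodule.span ℤ
        ((fun i => (e i : Fin m → ℤ)) '' {i | i.1 < k})).toAddSubgroup) by
    have := H 0 (Nat.zero_le n)
    simpa [congrSubmodule_bot] using this
  intro k hk
  induction hk using Nat.decreasingInduction with
  | self =>
    rw [List.drop_of_length_le (by simp)]
    rcases (Y \ Z).eq_empty_or_nonempty with h0 | ⟨x₀, hx₀⟩
    · refine ⟨⊥, inferInstance, ?_⟩
      rw [bot_sup_eq]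
      exact (monIdeal_mono (Set.sdiff_eq_empty.1 h0)).trans le_sup_right
    · refine ⟨Submodule.span K {mono K x₀}, inferInstance, ?_⟩
      have hYf : ∀ f ∈ monIdeal K S Y, f ∈ Submodule.span K {f | ∃ x ∈ Y, f = mono K x} := by
        intro f hf
        refine Submodule.span_mono ?_ (AddMonoidAlgebra.mem_span_support_coeff f)
        rintro _ ⟨x, hx, rfl⟩
        exact ⟨x, (mem_monIdeal hY).1 hf x (Finsupp.mem_support_iff.1 hx), rfl⟩
      intro f hf
      refine (Submodule.span_le.2 ?_) (hYf f hf)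
      rintro _ ⟨x, hx, rfl⟩
      by_cases hxZ : x ∈ Z
      · exact Submodule.mem_sup_right (Submodule.mem_sup_right
          (Submodule.subset_span ⟨x, hxZ, rfl⟩))
      · rw [← add_sub_cancel (mono K x₀) (mono K x)]
        refine Submodule.add_mem_sup (Submodule.mem_span_singleton_self _)
          (mono_sub_mono_mem ⟨hx, hxZ⟩ hx₀ ?_)
        have := hX x ⟨hx, hxZ⟩ x₀ hx₀
        simpa [Set.image_univ] using this
  | of_succ k hk ih =>
    rw [List.drop_eq_getElem_cons (by simpa using hk), List.getElem_ofFn]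
    have hsup : (Submodule.span ℤ
        ((fun i => (e i : Fin m → ℤ)) '' {i | i.1 < k})).toAddSubgroup ⊔
        AddSubgroup.zmultiples (e ⟨k, hk⟩ : Fin m → ℤ) = (Submodule.span ℤ
        ((fun i => (e i : Fin m → ℤ)) '' {i | i.1 < k + 1})).toAddSubgroup := by
      have : {i : Fin n | i.1 < k + 1} = {i | i.1 < k} ∪ {⟨k, hk⟩} := by
        ext i
        simp only [Fin.ext_iff, Set.mem_union, Set.mem_ofPred_eq, Set.mem_singleton_iff]
        omega
      rw [this, Set.image_union, Submodule.span_union, Submodule.sup_toAddSubgroup,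
        Set.image_singleton]
      congr 1
      ext x
      simp [AddSubgroup.mem_zmultiples_iff, Submodule.mem_span_singleton]
    refine FiniteRegular.cons_unit hY hZ hZY (e ⟨k, hk⟩) ?_ ?_ ?_
    · rw [hsup]
      exact hspan _
    · intro j hj
      have hj' : (j : ℤ) • (e ⟨k, hk⟩ : Fin m → ℤ) ∈ Submodule.span ℤ
          ((fun i => (e i : Fin m → ℤ)) '' (Set.univ \ {⟨k, hk⟩})) := by
        rw [natCast_zsmul]
        have hsub : {i : Fin n | i.1 < k} ⊆ Set.univ \ {⟨k, hk⟩} := by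
          intro i hi
          refine ⟨trivial, ?_⟩
          rintro rfl
          exact lt_irrefl _ (show k < k from hi)
        exact Submodule.span_mono (Set.image_mono hsub) hj
      exact_mod_cast linearIndependent_iff_eq_zero_of_smul_mem_span.1 hli ⟨k, hk⟩ j hj'
    · rw [hsup]
      exact ih

end UnitSequence

section LinearInequalities

variable {m : ℕ}

lemma lin_zsmul (f : Fin m → ℤ) (c : ℤ) (x : Fin m → ℤ) : lin f (c • x) = c * lin f x := by
  simp only [lin, Finset.mul_sum, Pi.smul_apply, smul_eq_mul]
  exact Finset.sum_congr rfl fun _ _ => by ring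

lemma lin_nsmul (f : Fin m → ℤ) (c : ℕ) (x : Fin m → ℤ) : lin f (c • x) = c * lin f x := by
  rw [← natCast_zsmul, lin_zsmul]

lemma lin_neg (f x : Fin m → ℤ) : lin f (-x) = -lin f x := by
  simp [lin]

lemma lin_sub (f x y : Fin m → ℤ) : lin f (x - y) = lin f x - lin f y := by
  rw [sub_eq_add_neg, lin_add, lin_neg, ← sub_eq_add_neg]

lemma lin_smul_sub_smul (a b : ℤ) (f g x : Fin m → ℤ) :
    lin (a • f - b • g) x = a * lin f x - b * lin g x := by
  simp only [lin, Finset.mul_sum, Pi.smul_apply, smul_eq_mul, Pi.sub_apply,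
    ← Finset.sum_sub_distrib]
  exact Finset.sum_congr rfl fun _ _ => by ring

lemma exists_forms_of_insert (F : Finset (Fin m → ℤ)) (g : Fin m → ℤ) :
    ∃ F' : Finset (Fin m → ℤ), ∀ x : Fin m → ℤ,
      (∃ k : ℕ, 0 < k ∧ ∃ n : ℕ, ∀ σ ∈ F, (n : ℤ) * lin σ g ≤ k * lin σ x) ↔
        ∀ σ ∈ F', 0 ≤ lin σ x := by
  classical
  refine ⟨F.filter (0 ≤ lin · g) ∪ ((F.filter (0 < lin · g)) ×ˢ (F.filter (lin · g < 0))).image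
    (fun p => lin p.1 g • p.2 - lin p.2 g • p.1), fun x => ⟨?_, fun h => ?_⟩⟩
  · rintro ⟨k, hk, n, hkn⟩ ρ hρ
    have hk' : (0 : ℤ) < k := by exact_mod_cast hk
    rcases Finset.mem_union.1 hρ with hρ | hρ
    · rw [Finset.mem_filter] at hρ
      have := hkn ρ hρ.1
      have h2 : 0 ≤ (n : ℤ) * lin ρ g := mul_nonneg (Int.natCast_nonneg n) hρ.2
      exact nonneg_of_mul_nonneg_right (h2.trans this) hk'
    · obtain ⟨⟨σ, τ⟩, hp, rfl⟩ := Finset.mem_image.1 hρ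
      simp only [Finset.mem_product, Finset.mem_filter] at hp
      obtain ⟨⟨hσ, hσg⟩, hτ, hτg⟩ := hp
      rw [lin_smul_sub_smul]
      have h1 := hkn σ hσ
      have h2 := hkn τ hτ
      refine nonneg_of_mul_nonneg_right (a := (k : ℤ)) ?_ hk'
      nlinarith
  · have h0 : ∀ σ ∈ F, 0 ≤ lin σ g → 0 ≤ lin σ x := fun σ hσ hg =>
      h σ (Finset.mem_union_left _ (Finset.mem_filter.2 ⟨hσ, hg⟩))
    have hpair : ∀ σ ∈ F, ∀ τ ∈ F, 0 < lin σ g → lin τ g < 0 →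
        0 ≤ lin σ g * lin τ x - lin τ g * lin σ x := fun σ hσ τ hτ h1 h2 => by
      rw [← lin_smul_sub_smul]
      refine h _ (Finset.mem_union_right _ (Finset.mem_image.2 ⟨(σ, τ), ?_, rfl⟩))
      simp [hσ, hτ, h1, h2]
    rcases (F.filter (0 < lin · g)).eq_empty_or_nonempty with he | hne
    · refine ⟨1, one_pos, ∑ σ ∈ F, (lin σ x).natAbs, fun σ hσ => ?_⟩
      have hle : lin σ g ≤ 0 := not_lt.1 (Finset.filter_eq_empty_iff.1 he hσ)
      rw [Nat.cast_one, one_mul]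
      rcases hle.eq_or_lt with h1 | h1
      · rw [h1, mul_zero]
        exact h0 σ hσ h1.ge
      · have h2 : (lin σ x).natAbs ≤ ∑ σ ∈ F, (lin σ x).natAbs :=
          Finset.single_le_sum (f := fun σ => (lin σ x).natAbs) (fun _ _ => Nat.zero_le _) hσ
        have h3 : ((lin σ x).natAbs : ℤ) ≤ ((∑ σ ∈ F, (lin σ x).natAbs : ℕ) : ℤ) := by
          exact_mod_cast h2
        have h4 : -lin σ x ≤ (lin σ x).natAbs := by omega
        nlinarith
    · obtain ⟨ρ, hρ, hmin⟩ := Finset.exists_min_image _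
        (fun σ => (lin σ x : ℚ) / (lin σ g : ℚ)) hne
      rw [Finset.mem_filter] at hρ
      have hρx := h0 ρ hρ.1 hρ.2.le
      refine ⟨(lin ρ g).toNat, by omega, (lin ρ x).toNat, fun σ hσ => ?_⟩
      rw [Int.toNat_of_nonneg hρ.2.le, Int.toNat_of_nonneg hρx]
      rcases lt_trichotomy (lin σ g) 0 with h1 | h1 | h1
      · have := hpair ρ hρ.1 σ hσ hρ.2 h1
        linarith
      · rw [h1, mul_zero]
        exact mul_nonneg hρ.2.le (h0 σ hσ h1.ge)
      · have := hmin σ (Finset.mem_filter.2 ⟨hσ, h1⟩)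
        rw [div_le_div_iff₀ (by exact_mod_cast hρ.2) (by exact_mod_cast h1)] at this
        have h2 : lin ρ x * lin σ g ≤ lin σ x * lin ρ g := by exact_mod_cast this
        linarith

/-- A finitely generated rational cone is cut out by finitely many linear inequalities. -/
lemma exists_forms_of_closure (s : Finset (Fin m → ℤ)) :
    ∃ F : Finset (Fin m → ℤ), ∀ x : Fin m → ℤ,
      (∃ k : ℕ, 0 < k ∧ k • x ∈ AddSubmonoid.closure (s : Set (Fin m → ℤ))) ↔
        ∀ σ ∈ F, 0 ≤ lin σ x := by
  classical
  induction s using Finset.induction_on with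
  | empty =>
    refine ⟨Finset.univ.image (fun i => Pi.single i 1) ∪
      Finset.univ.image (fun i => -Pi.single i 1), fun x => ?_⟩
    have hlin : ∀ i, lin (Pi.single i 1) x = x i := fun i => by
      simp [lin, Pi.single_apply]
    have hlin' : ∀ i, lin (-Pi.single i 1) x = -x i := fun i => by
      simp [lin, Pi.single_apply]
    have : (∀ σ ∈ Finset.univ.image (fun i : Fin m => (Pi.single i 1 : Fin m → ℤ)) ∪
      Finset.univ.image (fun i => -Pi.single i 1), 0 ≤ lin σ x) ↔ x = 0 := by
      constructor
      · intro h
        ext i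
        have h1 := h (Pi.single i 1) (by simp)
        have h2 := h (-Pi.single i 1) (by simp)
        rw [hlin] at h1
        rw [hlin'] at h2
        exact le_antisymm (neg_nonneg.1 h2) h1
      · rintro rfl σ -
        rw [lin_zero]
    rw [this]
    constructor
    · rintro ⟨k, hk, hx⟩
      rw [Finset.coe_empty, AddSubmonoid.closure_empty, AddSubmonoid.mem_bot] at hx
      exact (smul_eq_zero.1 hx).resolve_left hk.ne'
    · rintro rfl
      exact ⟨1, one_pos, by simp⟩
  | insert g s _ ih =>
    obtain ⟨F, hF⟩ := ih
    obtain ⟨F', hF'⟩ := exists_forms_of_insert F g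
    refine ⟨F', fun x => (?_ : _ ↔ _).trans (hF' x)⟩
    rw [Finset.coe_insert, Set.insert_eq, AddSubmonoid.closure_union]
    constructor
    · rintro ⟨k, hk, hx⟩
      obtain ⟨y, hy, z, hz, hyz⟩ := AddSubmonoid.mem_sup.1 hx
      obtain ⟨n, rfl⟩ := AddSubmonoid.mem_closure_singleton.1 hy
      refine ⟨k, hk, n, fun σ hσ => ?_⟩
      have h1 := (hF z).1 ⟨1, one_pos, by simpa using hz⟩ σ hσ
      rw [← lin_nsmul, ← lin_nsmul, ← hyz, lin_add]
      linarith
    · rintro ⟨k, hk, n, h⟩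
      obtain ⟨j, hj, hjx⟩ := (hF (k • x - n • g)).2 fun σ hσ => by
        rw [lin_sub, lin_nsmul, lin_nsmul]
        linarith [h σ hσ]
      refine ⟨j * k, Nat.mul_pos hj hk, AddSubmonoid.mem_sup.2
        ⟨(j * n) • g, AddSubmonoid.mem_closure_singleton.2 ⟨_, rfl⟩, _, hjx, ?_⟩⟩
      rw [smul_sub, mul_smul, mul_smul, add_sub_cancel]

lemma exists_forms_of_normal {S : AddSubmonoid (Fin m → ℤ)} (hSfg : S.FG)
    (hS : ∀ x : Fin m → ℤ, x ∈ AddSubgroup.closure (S : Set (Fin m → ℤ)) →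
      ∀ k : ℕ, 0 < k → k • x ∈ S → x ∈ S) :
    ∃ F : Finset (Fin m → ℤ), ∀ x ∈ AddSubgroup.closure (S : Set (Fin m → ℤ)),
      x ∈ S ↔ ∀ σ ∈ F, 0 ≤ lin σ x := by
  obtain ⟨s, rfl⟩ := hSfg
  obtain ⟨F, hF⟩ := exists_forms_of_closure s
  refine ⟨F, fun x hx => ?_⟩
  rw [← hF]
  exact ⟨fun h => ⟨1, one_pos, by simpa using h⟩, fun ⟨k, hk, h⟩ => hS x hx k hk h⟩

end LinearInequalities

section Faces

variable {m : ℕ}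

/-- The linear form with coefficient vector `f`. -/
def linMap (f : Fin m → ℤ) : (Fin m → ℤ) →ₗ[ℤ] ℤ where
  toFun := lin f
  map_add' := lin_add f
  map_smul' := lin_zsmul f

/-- The sublattice of `gp(S)` on which all forms in `J` vanish. -/
def faceLattice (S : AddSubmonoid (Fin m → ℤ)) (J : Finset (Fin m → ℤ)) :
    Submodule ℤ (Fin m → ℤ) where
  carrier := {x | x ∈ AddSubgroup.closure (S : Set (Fin m → ℤ)) ∧ ∀ σ ∈ J, lin σ x = 0}
  add_mem' := fun ⟨h1, h2⟩ ⟨h3, h4⟩ =>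
    ⟨add_mem h1 h3, fun σ hσ => by rw [lin_add, h2 σ hσ, h4 σ hσ, add_zero]⟩
  zero_mem' := ⟨zero_mem _, fun σ _ => lin_zero σ⟩
  smul_mem' := fun c x ⟨h1, h2⟩ =>
    ⟨zsmul_mem h1 c, fun σ hσ => by rw [lin_zsmul, h2 σ hσ, mul_zero]⟩

/-- `J` is the set of all forms in `F` vanishing at some point of `S`. -/
def IsFlat (S : AddSubmonoid (Fin m → ℤ)) (F J : Finset (Fin m → ℤ)) : Prop :=
  J ⊆ F ∧ ∃ v : S, ∀ σ ∈ F, σ ∈ J ↔ lin σ v = 0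

variable {S : AddSubmonoid (Fin m → ℤ)} {F J J' : Finset (Fin m → ℤ)}

open Classical in
variable (S F J) in
/-- A point of `S` whose vanishing forms are exactly those in `J`, if there is one. -/
def flatPoint : S := if h : IsFlat S F J then h.2.choose else 0

lemma IsFlat.mem_iff (h : IsFlat S F J) {σ : Fin m → ℤ} (hσ : σ ∈ F) :
    σ ∈ J ↔ lin σ (flatPoint S F J : Fin m → ℤ) = 0 := by
  rw [flatPoint, dif_pos h]
  exact h.2.choose_spec σ hσ

lemma IsFlat.flatPoint_mem (h : IsFlat S F J) :
    (flatPoint S F J : Fin m → ℤ) ∈ faceLattice S J :=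
  ⟨AddSubgroup.subset_closure (flatPoint S F J).2, fun _ hσ => (h.mem_iff (h.1 hσ)).1 hσ⟩

lemma faceLattice_anti (h : J ⊆ J') : faceLattice S J' ≤ faceLattice S J :=
  fun _ hx => ⟨hx.1, fun σ hσ => hx.2 σ (h hσ)⟩

lemma finrank_inf_ker_add_one (N : Submodule ℤ (Fin m → ℤ)) (φ : (Fin m → ℤ) →ₗ[ℤ] ℤ)
    {x : Fin m → ℤ} (hx : x ∈ N) (hφ : φ x ≠ 0) :
    Module.finrank ℤ ↥(N ⊓ LinearMap.ker φ) + 1 = Module.finrank ℤ N := by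
  have h1 := (LinearMap.ker (φ.comp N.subtype)).finrank_quotient_add_finrank
  rw [(φ.comp N.subtype).quotKerEquivRange.finrank_eq] at h1
  have h2 : Module.finrank ℤ ↥(LinearMap.range (φ.comp N.subtype)) = 1 := by
    apply le_antisymm
    · simpa using Submodule.finrank_le (LinearMap.range (φ.comp N.subtype))
    · rw [Nat.one_le_iff_ne_zero, Ne, Submodule.finrank_eq_zero]
      intro h
      refine hφ ?_
      have : φ x ∈ LinearMap.range (φ.comp N.subtype) := ⟨⟨x, hx⟩, rfl⟩
      rwa [h, Submodule.mem_bot] at this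
  have h3 : Module.finrank ℤ ↥(LinearMap.ker (φ.comp N.subtype)) =
      Module.finrank ℤ ↥(N ⊓ LinearMap.ker φ) := by
    rw [LinearMap.ker_comp, ← Submodule.map_comap_subtype]
    exact (Submodule.equivSubtypeMap N _).finrank_eq
  omega

lemma IsFlat.finrank_lt (h : IsFlat S F J) (hJ' : J' ⊆ F) (hJJ' : J ⊆ J') (hne : J ≠ J') :
    Module.finrank ℤ (faceLattice S J') < Module.finrank ℤ (faceLattice S J) := by
  obtain ⟨σ, hmem, hσ⟩ := Finset.exists_of_ssubset (hJJ'.ssubset_of_ne hne)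
  rw [← finrank_inf_ker_add_one _ (linMap σ) h.flatPoint_mem
    (fun h0 => hσ ((h.mem_iff (hJ' hmem)).2 h0)), Nat.lt_succ_iff]
  exact Submodule.finrank_mono (le_inf (faceLattice_anti hJJ') fun x hx => hx.2 σ hmem)

/-- A lattice point avoiding finitely many proper hyperplanes. -/
lemma exists_forall_ne_zero {ι : Type*} (N : Submodule ℤ (Fin m → ℤ)) (s : Finset ι)
    (φ : ι → (Fin m → ℤ) →ₗ[ℤ] ℤ) (h : ∀ i ∈ s, ∃ z ∈ N, φ i z ≠ 0) :
    ∃ u ∈ N, ∀ i ∈ s, φ i u ≠ 0 := by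
  classical
  induction s using Finset.induction_on with
  | empty => exact ⟨0, N.zero_mem, by simp⟩
  | insert i s _ ih =>
    obtain ⟨u, hu, hus⟩ := ih fun j hj => h j (Finset.mem_insert_of_mem hj)
    by_cases hi : φ i u = 0
    · obtain ⟨z, hz, hiz⟩ := h i (Finset.mem_insert_self _ _)
      refine ⟨(1 + ∑ j ∈ s, |φ j z|) • u + z, N.add_mem (N.smul_mem _ hu) hz, fun j hj => ?_⟩
      rw [map_add, map_smul, smul_eq_mul]
      rcases Finset.mem_insert.1 hj with rfl | hj
      · rwa [hi, mul_zero, zero_add]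
      · intro h0
        have h1 : |φ j z| ≤ ∑ j ∈ s, |φ j z| :=
          Finset.single_le_sum (f := fun j => |φ j z|) (fun _ _ => abs_nonneg _) hj
        have h2 : |φ j z| = (1 + ∑ j ∈ s, |φ j z|) * |φ j u| := by
          rw [← abs_neg, ← eq_neg_of_add_eq_zero_left h0, abs_mul,
            abs_of_pos (by linarith [abs_nonneg (φ j z)])]
        have h3 : 1 ≤ |φ j u| := Int.one_le_abs (hus j hj)
        nlinarith [abs_nonneg (φ j z)]
    · exact ⟨u, hu, fun j hj => (Finset.mem_insert.1 hj).elim (fun e => e ▸ hi) (hus j)⟩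

end Faces

section LevelSets

variable {m : ℕ} {S : AddSubmonoid (Fin m → ℤ)} {F J J' : Finset (Fin m → ℤ)} {w : Fin m → ℤ}

variable (S F w) in
/-- The points of the coset `-w + gp(S)` satisfying inequalities with right hand side `p / N` for
all forms in `F`, with equality for the forms in `J`. -/
def levelSet (J : Finset (Fin m → ℤ)) (N : ℤ) (p : Fin m → ℤ) : Set (Fin m → ℤ) :=
  {x | x + w ∈ AddSubgroup.closure (S : Set (Fin m → ℤ)) ∧
    (∀ σ ∈ J, N * lin σ x = lin σ p) ∧ ∀ σ ∈ F, lin σ p ≤ N * lin σ x}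

variable {N : ℤ} {p : Fin m → ℤ}

lemma sub_mem_closure_of_levelSet {N' : ℤ} {p' x y : Fin m → ℤ} (hx : x ∈ levelSet S F w J N p)
    (hy : y ∈ levelSet S F w J' N' p') :
    x - y ∈ AddSubgroup.closure (S : Set (Fin m → ℤ)) := by
  have := sub_mem hx.1 hy.1
  rwa [add_sub_add_right_eq_sub] at this

lemma sub_mem_faceLattice {x y : Fin m → ℤ} (hN : 0 < N) (hx : x ∈ levelSet S F w J N p)
    (hy : y ∈ levelSet S F w J N p) : x - y ∈ faceLattice S J := by
  refine ⟨sub_mem_closure_of_levelSet hx hy, fun σ hσ => ?_⟩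
  have : N * (lin σ x - lin σ y) = 0 := by
    rw [mul_sub, hx.2.1 σ hσ, hy.2.1 σ hσ, sub_self]
  rw [lin_sub]
  exact (mul_eq_zero.1 this).resolve_left (ne_of_gt hN)

/-- Moving into `S` along the face lattice preserves level sets. -/
lemma add_mem_levelSet {s x : Fin m → ℤ} (hN : 0 < N) (hsJ : s ∈ faceLattice S J)
    (hsF : ∀ σ ∈ F, 0 ≤ lin σ s) (hx : x ∈ levelSet S F w J N p) :
    s + x ∈ levelSet S F w J N p := by
  refine ⟨?_, fun σ hσ => ?_, fun σ hσ => ?_⟩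
  · rw [add_assoc]
    exact add_mem hsJ.1 hx.1
  · rw [lin_add, hsJ.2 σ hσ, zero_add, hx.2.1 σ hσ]
  · rw [lin_add]
    have := mul_nonneg hN.le (hsF σ hσ)
    linarith [hx.2.2 σ hσ]

/-- A point witnessing which inequalities are equalities shows that they form a flat. -/
lemma isFlat_of_mem_levelSet
    (hF : ∀ x ∈ AddSubgroup.closure (S : Set (Fin m → ℤ)), x ∈ S ↔ ∀ σ ∈ F, 0 ≤ lin σ x)
    {k : ℕ} (hk : 0 < k) (hkw : k • w ∈ AddSubgroup.closure (S : Set (Fin m → ℤ)))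
    (hp : p ∈ AddSubgroup.closure (S : Set (Fin m → ℤ))) {x : Fin m → ℤ}
    (hx : x ∈ levelSet S F w J N p) :
    IsFlat S F (F.filter fun σ => N * lin σ x = lin σ p) := by
  have hk' : (0 : ℤ) < k := by exact_mod_cast hk
  have hG : (k : ℤ) • (N • x - p) ∈ AddSubgroup.closure (S : Set (Fin m → ℤ)) := by
    have h1 : (k : ℤ) • x ∈ AddSubgroup.closure (S : Set (Fin m → ℤ)) := by
      have := sub_mem (nsmul_mem hx.1 k) hkw
      rw [natCast_zsmul]
      simpa [smul_add] using this
    rw [smul_sub, smul_comm]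
    exact sub_mem (zsmul_mem h1 _) (zsmul_mem hp _)
  have hlin : ∀ σ, lin σ ((k : ℤ) • (N • x - p)) = k * (N * lin σ x - lin σ p) := fun σ => by
    rw [lin_zsmul, lin_sub, lin_zsmul]
  refine ⟨Finset.filter_subset _ _, ⟨_, (hF _ hG).2 fun σ hσ => ?_⟩, fun σ hσ => ?_⟩
  · rw [hlin]
    exact mul_nonneg hk'.le (sub_nonneg.2 (hx.2.2 σ hσ))
  · rw [hlin, Finset.mem_filter, mul_eq_zero, or_iff_right hk'.ne', sub_eq_zero]
    exact and_iff_right hσ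

lemma Finset.exists_int_forall_lt {ι : Type*} (s : Finset ι) (g : ι → ℤ) :
    ∃ E : ℤ, 0 < E ∧ ∀ i ∈ s, g i < E := by
  refine ⟨1 + ∑ i ∈ s, |g i|, ?_, fun i hi => ?_⟩
  · have := Finset.sum_nonneg (s := s) fun i _ => abs_nonneg (g i)
    linarith
  · have := Finset.single_le_sum (f := fun i => |g i|) (fun i _ => abs_nonneg _) hi
    have h2 := le_abs_self (g i)
    linarith

/-- A generic direction in a face, small compared to some integer `E`. -/
lemma exists_generic_direction (hJ : IsFlat S F J)
    (hSF : ∀ x ∈ S, ∀ σ ∈ F, 0 ≤ lin σ x) (v : Fin m → ℤ) (hv : v = flatPoint S F J) :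
    ∃ u ∈ faceLattice S J, ∃ E : ℤ, 0 < E ∧ (∀ i ∈ F, 0 ≤ lin i u ∧ lin i u < E) ∧
      ∀ i ∈ F, ∀ j ∈ F,
        E ∣ lin i v * lin j u - lin j v * lin i u →
          ∀ z ∈ faceLattice S J, lin i v * lin j z = lin j v * lin i z := by
  classical
  let φ : (Fin m → ℤ) × (Fin m → ℤ) → (Fin m → ℤ) →ₗ[ℤ] ℤ := fun q =>
    lin q.1 v • linMap q.2 - lin q.2 v • linMap q.1
  have hφ : ∀ q z, φ q z = lin q.1 v * lin q.2 z - lin q.2 v * lin q.1 z := fun q z => rfl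
  obtain ⟨u, hu, hune⟩ := exists_forall_ne_zero (faceLattice S J)
    ((F ×ˢ F).filter fun q => ∃ z ∈ faceLattice S J, φ q z ≠ 0) φ
    (fun q hq => (Finset.mem_filter.1 hq).2)
  have hvJ : v ∈ faceLattice S J := hv ▸ hJ.flatPoint_mem
  have hvF : ∀ i ∈ F, 0 ≤ lin i v := hv ▸ hSF _ (flatPoint S F J).2
  obtain ⟨c, hc, hcu⟩ := Finset.exists_int_forall_lt F fun i => -lin i u
  obtain ⟨E₁, hE₁, hE₁u⟩ := Finset.exists_int_forall_lt F fun i => lin i (u + c • v)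
  obtain ⟨E₂, hE₂, hE₂u⟩ := Finset.exists_int_forall_lt (F ×ˢ F) fun q => |φ q u|
  refine ⟨u + c • v, add_mem hu (Submodule.smul_mem _ _ hvJ), E₁ + E₂, by linarith,
    fun i hi => ⟨?_, by linarith [hE₁u i hi]⟩, fun i hi j hj hdvd z hz => ?_⟩
  · rw [lin_add, lin_zsmul]
    by_cases hiJ : i ∈ J
    · rw [hu.2 i hiJ, hvJ.2 i hiJ]; simp
    · have h1 : lin i v ≠ 0 := fun h0 => hiJ ((hJ.mem_iff hi).2 (hv ▸ h0))
      have h2 : 1 ≤ lin i v := by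
        have := hvF i hi
        omega
      nlinarith [hcu i hi]
  · by_contra hne
    have hmem : (i, j) ∈ (F ×ˢ F).filter fun q => ∃ z ∈ faceLattice S J, φ q z ≠ 0 :=
      Finset.mem_filter.2 ⟨Finset.mk_mem_product hi hj, z, hz, by
        rw [hφ]; exact sub_ne_zero.2 hne⟩
    refine hune _ hmem ?_
    have e : lin i v * lin j (u + c • v) - lin j v * lin i (u + c • v) = φ (i, j) u := by
      rw [hφ, lin_add, lin_add, lin_zsmul, lin_zsmul]
      ring
    rw [e] at hdvd
    refine Int.eq_zero_of_abs_lt_dvd hdvd ?_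
    have := hE₂u (i, j) (Finset.mk_mem_product hi hj)
    linarith

end LevelSets

section Slices

variable {m : ℕ} {S : AddSubmonoid (Fin m → ℤ)} {F J : Finset (Fin m → ℤ)}
  {w u v p : Fin m → ℤ} {N E D : ℤ}

/-- The right hand sides interpolating between `p / N` and `p / N + v`. -/
def slicePoint (E D : ℤ) (p u v : Fin m → ℤ) (a : ℕ) : Fin m → ℤ :=
  (D * E) • p - D • u + (a : ℤ) • v

lemma lin_slicePoint (σ : Fin m → ℤ) (a : ℕ) :
    lin σ (slicePoint E D p u v a) = D * E * lin σ p - D * lin σ u + a * lin σ v := by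
  rw [slicePoint, lin_add, lin_sub, lin_zsmul, lin_zsmul, lin_zsmul]

lemma exists_equality_of_mem_slice (hv : v ∈ faceLattice S J) (hvF : ∀ i ∈ F, 0 ≤ lin i v)
    (hD : ∀ i ∈ F, lin i v ≠ 0 → lin i v ∣ D)
    {a : ℕ} {x : Fin m → ℤ}
    (hx : x ∈ levelSet S F w J (D * (N * E)) (slicePoint E D p u v a))
    (hx' : x ∉ levelSet S F w J (D * (N * E)) (slicePoint E D p u v (a + 1))) :
    ∃ i ∈ F, lin i v ≠ 0 ∧ D * (N * E) * lin i x = lin i (slicePoint E D p u v a) := by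
  have hsucc : ∀ σ, lin σ (slicePoint E D p u v (a + 1)) =
      lin σ (slicePoint E D p u v a) + lin σ v := fun σ => by
    rw [lin_slicePoint, lin_slicePoint]
    push_cast
    ring
  have : ∃ i ∈ F, D * (N * E) * lin i x < lin i (slicePoint E D p u v (a + 1)) := by
    by_contra! hno
    exact hx' ⟨hx.1, fun σ hσ => by rw [hsucc, hv.2 σ hσ, add_zero, hx.2.1 σ hσ], hno⟩
  obtain ⟨i, hi, hlt⟩ := this
  rw [hsucc] at hlt
  have hge := hx.2.2 i hi
  have hvi : lin i v ≠ 0 := by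
    intro h0
    rw [h0] at hlt
    linarith
  refine ⟨i, hi, hvi, le_antisymm ?_ hge⟩
  have hpos : 0 < lin i v := lt_of_le_of_ne (hvF i hi) (Ne.symm hvi)
  obtain ⟨c, hc⟩ := hD i hi hvi
  have e : D * (N * E) * lin i x - lin i (slicePoint E D p u v a) =
      lin i v * (c * (N * E * lin i x - E * lin i p + lin i u) - a) := by
    rw [lin_slicePoint, hc]
    ring
  have h1 : lin i v * (c * (N * E * lin i x - E * lin i p + lin i u) - a) < lin i v * 1 := by
    rw [← e]
    linarith
  have h2 := lt_of_mul_lt_mul_left h1 hpos.le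
  have h3 : lin i v * (c * (N * E * lin i x - E * lin i p + lin i u) - a) ≤ 0 :=
    mul_nonpos_of_nonneg_of_nonpos hpos.le (by linarith [Int.lt_add_one_iff.1 (by linarith :
      (c * (N * E * lin i x - E * lin i p + lin i u) - a) < 0 + 1)])
  linarith

lemma dvd_of_equalities (hDpos : 0 < D) {a : ℕ} {x y i j : Fin m → ℤ}
    (hi : D * (N * E) * lin i x = lin i (slicePoint E D p u v a))
    (hj : D * (N * E) * lin j y = lin j (slicePoint E D p u v a)) :
    E ∣ lin i v * lin j u - lin j v * lin i u := by
  rw [lin_slicePoint] at hi hj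
  refine ⟨lin j v * (N * lin i x - lin i p) - lin i v * (N * lin j y - lin j p), ?_⟩
  have h0 : D * ((lin i v * lin j u - lin j v * lin i u) -
      E * (lin j v * (N * lin i x - lin i p) - lin i v * (N * lin j y - lin j p))) = 0 := by
    linear_combination (-lin j v) * hi + lin i v * hj
  exact sub_eq_zero.1 ((mul_eq_zero.1 h0).resolve_left (ne_of_gt hDpos))

/-- Each nonempty slice is a level set of a facet of the face given by `J`. -/
lemma slice_eq_levelSet (hJ : IsFlat S F J) (hvJ : v = flatPoint S F J)
    (hSF : ∀ x ∈ S, ∀ σ ∈ F, 0 ≤ lin σ x)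
    (hE : 0 < E) (hN : 0 < N) (hDpos : 0 < D) (hD : ∀ i ∈ F, lin i v ≠ 0 → lin i v ∣ D)
    (hdvd : ∀ i ∈ F, ∀ j ∈ F, E ∣ lin i v * lin j u - lin j v * lin i u →
      ∀ z ∈ faceLattice S J, lin i v * lin j z = lin j v * lin i z)
    {a : ℕ} {x₀ : Fin m → ℤ}
    (hx₀ : x₀ ∈ levelSet S F w J (D * (N * E)) (slicePoint E D p u v a))
    (hx₀' : x₀ ∉ levelSet S F w J (D * (N * E)) (slicePoint E D p u v (a + 1)))
    {J' : Finset (Fin m → ℤ)}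
    (hJ' : J' = F.filter fun σ => D * (N * E) * lin σ x₀ = lin σ (slicePoint E D p u v a)) :
    Module.finrank ℤ (faceLattice S J') + 1 = Module.finrank ℤ (faceLattice S J) ∧
      levelSet S F w J (D * (N * E)) (slicePoint E D p u v a) \
        levelSet S F w J (D * (N * E)) (slicePoint E D p u v (a + 1)) =
      levelSet S F w J' (D * (N * E)) (slicePoint E D p u v a) := by
  have hM : 0 < D * (N * E) := by positivity
  have hv : v ∈ faceLattice S J := hvJ ▸ hJ.flatPoint_mem
  have hvF : ∀ i ∈ F, 0 ≤ lin i v := hvJ ▸ hSF _ (flatPoint S F J).2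
  have hmemJ' : ∀ {i}, i ∈ J' ↔ i ∈ F ∧
      D * (N * E) * lin i x₀ = lin i (slicePoint E D p u v a) := by
    simp [hJ']
  have hJJ' : J ⊆ J' := fun i hi => hmemJ'.2 ⟨hJ.1 hi, hx₀.2.1 i hi⟩
  obtain ⟨i, hi, hiv, hix⟩ := exists_equality_of_mem_slice hv hvF hD hx₀ hx₀'
  have hvanish : ∀ z ∈ faceLattice S J, lin i z = 0 → ∀ j ∈ J', lin j z = 0 := by
    intro z hz hiz j hj
    have hj' := hmemJ'.1 hj
    have := hdvd i hi j hj'.1 (dvd_of_equalities hDpos hix hj'.2) z hz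
    rw [hiz, mul_zero] at this
    exact (mul_eq_zero.1 this).resolve_left hiv
  constructor
  · have hinf : faceLattice S J' = faceLattice S J ⊓ LinearMap.ker (linMap i) := by
      apply le_antisymm
      · exact le_inf (faceLattice_anti hJJ') fun z hz => hz.2 i (hmemJ'.2 ⟨hi, hix⟩)
      · rintro z ⟨hz, hiz⟩
        exact ⟨hz.1, hvanish z hz hiz⟩
    rw [hinf]
    exact finrank_inf_ker_add_one _ (linMap i) hv hiv
  · ext x
    constructor
    · rintro ⟨hx, hx'⟩
      obtain ⟨j, hj, hjv, hjx⟩ := exists_equality_of_mem_slice hv hvF hD hx hx'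
      have hz := sub_mem_faceLattice hM hx hx₀
      have hprop := hdvd i hi j hj (dvd_of_equalities hDpos hix hjx) _ hz
      have hipos : 0 < lin i v := lt_of_le_of_ne (hvF i hi) (Ne.symm hiv)
      have hjpos : 0 < lin j v := lt_of_le_of_ne (hvF j hj) (Ne.symm hjv)
      have h1 : 0 ≤ lin i (x - x₀) := by
        rw [lin_sub]
        have := hx.2.2 i hi
        rw [← hix] at this
        exact sub_nonneg.2 (le_of_mul_le_mul_left this hM)
      have h2 : lin j (x - x₀) ≤ 0 := by
        rw [lin_sub]
        have := hx₀.2.2 j hj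
        rw [← hjx] at this
        exact sub_nonpos.2 (le_of_mul_le_mul_left this hM)
      have h3 : lin i (x - x₀) = 0 := by
        have h4 : lin j v * lin i (x - x₀) ≤ 0 := by
          rw [← hprop]
          exact mul_nonpos_of_nonneg_of_nonpos hipos.le h2
        exact le_antisymm (nonpos_of_mul_nonpos_right h4 hjpos) h1
      refine ⟨hx.1, fun k hk => ?_, hx.2.2⟩
      have h4 := hvanish _ hz h3 k hk
      rw [lin_sub, sub_eq_zero] at h4
      rw [h4]
      exact (hmemJ'.1 hk).2
    · intro hx
      refine ⟨⟨hx.1, fun k hk => hx.2.1 k (hJJ' hk), hx.2.2⟩, fun hx' => ?_⟩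
      have h1 := hx.2.1 i (hmemJ'.2 ⟨hi, hix⟩)
      have h2 := hx'.2.2 i hi
      rw [h1, lin_slicePoint, lin_slicePoint] at h2
      have hipos : 0 < lin i v := lt_of_le_of_ne (hvF i hi) (Ne.symm hiv)
      push_cast at h2
      nlinarith

end Slices

section Systems

variable {K : Type*} [Field K] {m : ℕ} {S : AddSubmonoid (Fin m → ℤ)}
  {F J : Finset (Fin m → ℤ)} {w p : Fin m → ℤ} {N : ℤ}

lemma FiniteRegular.of_slices {rs : List (semigroupRing K S)}
    (hF : ∀ x ∈ AddSubgroup.closure (S : Set (Fin m → ℤ)), x ∈ S ↔ ∀ σ ∈ F, 0 ≤ lin σ x)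
    {k : ℕ} (hk : 0 < k) (hkw : k • w ∈ AddSubgroup.closure (S : Set (Fin m → ℤ)))
    (hJ : IsFlat S F J) (hN : 0 < N) (hp : p ∈ AddSubgroup.closure (S : Set (Fin m → ℤ)))
    {Y Z : Set (Fin m → ℤ)} (hY : StableUnder S Y) (hZ : StableUnder S Z) (hZY : Z ⊆ Y)
    (hYZ : Y \ Z = levelSet S F w J N p)
    (ih : ∀ J', IsFlat S F J' →
      Module.finrank ℤ (faceLattice S J') + 1 = Module.finrank ℤ (faceLattice S J) →
      ∀ N : ℤ, 0 < N → ∀ p ∈ AddSubgroup.closure (S : Set (Fin m → ℤ)), ∀ Y Z,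
      StableUnder S Y → StableUnder S Z → Z ⊆ Y → Y \ Z = levelSet S F w J' N p →
      FiniteRegular K rs (monIdeal K S Y) (monIdeal K S Z)) :
    FiniteRegular K rs (monIdeal K S Y)
      (monIdeal K S ({x | x - (flatPoint S F J : Fin m → ℤ) ∈ Y} ∪ Z)) := by
  classical
  have hSF : ∀ x ∈ S, ∀ σ ∈ F, 0 ≤ lin σ x := fun x hx =>
    (hF x (AddSubgroup.subset_closure hx)).1 hx
  obtain ⟨u, hu, E, hE, huE, hdvd⟩ := exists_generic_direction hJ hSF _ rfl
  set v : Fin m → ℤ := ↑(flatPoint S F J) with hvdef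
  have hvJ : v ∈ faceLattice S J := hJ.flatPoint_mem
  have hvS : v ∈ S := (flatPoint S F J).2
  have hvF : ∀ i ∈ F, 0 ≤ lin i v := hSF _ hvS
  set D : ℤ := ∏ i ∈ F, if lin i v = 0 then 1 else lin i v with hDdef
  have hDpos : 0 < D := Finset.prod_pos fun i hi => by
    split_ifs with h0
    · exact one_pos
    · exact lt_of_le_of_ne (hvF i hi) (Ne.symm h0)
  have hD : ∀ i ∈ F, lin i v ≠ 0 → lin i v ∣ D := fun i hi h0 => by
    have := Finset.dvd_prod_of_mem (fun i => if lin i v = 0 then 1 else lin i v) hi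
    simpa [h0] using this
  have hM : 0 < D * (N * E) := by positivity
  set T : ℕ → Set (Fin m → ℤ) := fun a =>
    levelSet S F w J (D * (N * E)) (slicePoint E D p u v a) with hT
  have hT0 : T 0 = Y \ Z := by
    rw [hYZ]
    ext x
    refine and_congr_right fun _ => and_congr ?_ ?_
    · refine forall₂_congr fun σ hσ => ?_
      rw [lin_slicePoint, hu.2 σ hσ]
      have hDE : D * E ≠ 0 := by positivity
      constructor
      · intro h
        refine mul_left_cancel₀ hDE ?_
        push_cast at h
        linarith
      · intro h
        push_cast
        linear_combination (D * E) * h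
    · refine forall₂_congr fun σ hσ => ?_
      rw [lin_slicePoint]
      push_cast
      have e : D * E * lin σ p - D * lin σ u + 0 * lin σ v ≤ D * (N * E) * lin σ x ↔
          E * (lin σ p - N * lin σ x) ≤ lin σ u := by
        rw [← sub_nonneg, ← sub_nonneg (b := E * _), ← mul_nonneg_iff_of_pos_left
          (b := lin σ u - E * (lin σ p - N * lin σ x)) hDpos]
        ring_nf
      rw [e]
      constructor
      · intro h
        have h1 : E * (lin σ p - N * lin σ x) < E * 1 := by linarith [(huE σ hσ).2]
        have := lt_of_mul_lt_mul_left h1 hE.le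
        linarith [Int.lt_add_one_iff.1 (by linarith : lin σ p - N * lin σ x < 0 + 1)]
      · intro h
        exact (mul_nonpos_of_nonneg_of_nonpos hE.le (by linarith)).trans (huE σ hσ).1
  have hTanti : ∀ a, T (a + 1) ⊆ T a := by
    intro a x hx
    have hs : ∀ σ, lin σ (slicePoint E D p u v (a + 1)) =
        lin σ (slicePoint E D p u v a) + lin σ v := fun σ => by
      rw [lin_slicePoint, lin_slicePoint]
      push_cast
      ring
    refine ⟨hx.1, fun σ hσ => ?_, fun σ hσ => ?_⟩
    · rw [hx.2.1 σ hσ, hs, hvJ.2 σ hσ, add_zero]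
    · have := hx.2.2 σ hσ
      rw [hs] at this
      linarith [hvF σ hσ]
  have hTT : ∀ a, T a ⊆ Y \ Z := fun a => hT0 ▸ antitone_nat_of_succ_le hTanti (Nat.zero_le a)
  set M : ℕ := (D * (N * E)).toNat with hMdef
  have hMcast : (M : ℤ) = D * (N * E) := Int.toNat_of_nonneg hM.le
  have hTM : ∀ x, x ∈ T M ↔ x - v ∈ T 0 := by
    intro x
    have hs : ∀ σ, lin σ (slicePoint E D p u v M) =
        lin σ (slicePoint E D p u v 0) + D * (N * E) * lin σ v := fun σ => by
      rw [lin_slicePoint, lin_slicePoint, hMcast]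
      push_cast
      ring
    refine and_congr ?_ (and_congr ?_ ?_)
    · rw [sub_add_eq_add_sub, sub_eq_add_neg]
      exact (add_mem_cancel_right (neg_mem (AddSubgroup.subset_closure hvS))).symm
    · refine forall₂_congr fun σ _ => ?_
      rw [hs, lin_sub, mul_sub, sub_eq_iff_eq_add]
    · refine forall₂_congr fun σ _ => ?_
      rw [hs, lin_sub, mul_sub, le_sub_iff_add_le]
  have hstab : ∀ a, StableUnder S (T a ∪ Z) := by
    rintro a s hs x (hx | hx)
    · by_cases hsx : s + x ∈ Z
      · exact Or.inr hsx
      have h1 : s + x ∈ levelSet S F w J N p := hYZ ▸ ⟨hY s hs x (hTT a hx).1, hsx⟩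
      have h2 : x ∈ levelSet S F w J N p := hYZ ▸ hTT a hx
      have h3 := sub_mem_faceLattice hN h1 h2
      rw [add_sub_cancel_right] at h3
      exact Or.inl (add_mem_levelSet hM h3 (hSF s hs) hx)
    · exact Or.inr (hZ s hs x hx)
  have hdiff : ∀ a, (T a ∪ Z) \ (T (a + 1) ∪ Z) = T a \ T (a + 1) := by
    intro a
    ext x
    have := @hTT a x
    simp only [Set.mem_sdiff, Set.mem_union] at this ⊢
    tauto
  have h0 : T 0 ∪ Z = Y := by rw [hT0, Set.sdiff_union_of_subset hZY]
  have hlast : T M ∪ Z = {x | x - v ∈ Y} ∪ Z := by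
    ext x
    rw [Set.mem_union, Set.mem_union, hTM, hT0, Set.mem_ofPred_eq, Set.mem_sdiff]
    have : x - v ∈ Z → x ∈ Z := fun h => by simpa using hZ v hvS _ h
    tauto
  have hpa : ∀ a, slicePoint E D p u v a ∈ AddSubgroup.closure (S : Set (Fin m → ℤ)) := fun a =>
    add_mem (sub_mem (zsmul_mem hp _) (zsmul_mem hu.1 _)) (zsmul_mem hvJ.1 _)
  have hchain := FiniteRegular.of_chain (K := K) (rs := rs) (fun a => monIdeal K S (T a ∪ Z))
    (fun a => monIdeal_mono (Set.union_subset_union_left _ (hTanti a))) (fun a => ?_) M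
  · simpa only [h0, hlast] using hchain
  · have hsub : T (a + 1) ∪ Z ⊆ T a ∪ Z := Set.union_subset_union_left _ (hTanti a)
    rcases (T a \ T (a + 1)).eq_empty_or_nonempty with hemp | ⟨x₀, hx₀, hx₀'⟩
    · have : T (a + 1) = T a := (hTanti a).antisymm (Set.sdiff_eq_empty.1 hemp)
      simp only [this]
      exact .refl _ _
    · obtain ⟨hrk, heq⟩ := slice_eq_levelSet hJ hvdef hSF hE hN hDpos hD hdvd hx₀ hx₀' rfl
      refine ih _ (isFlat_of_mem_levelSet hF hk hkw (hpa a) hx₀) hrk _ hM _ (hpa a) _ _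
        (hstab a) (hstab (a + 1)) hsub ?_
      rw [hdiff]
      exact heq

end Systems

section FaceSums

variable {K : Type*} [Field K] {m : ℕ} {S : AddSubmonoid (Fin m → ℤ)}
  {F : Finset (Fin m → ℤ)} {w : Fin m → ℤ}

open Classical in
variable (K S F) in
/-- The sum of monomials, one from the relative interior of each face of rank `k`. -/
def faceSum (k : ℕ) : semigroupRing K S :=
  ∑ J ∈ F.powerset with IsFlat S F J ∧ Module.finrank ℤ (faceLattice S J) = k,
    ringMono (flatPoint S F J)

variable (F) in
/-- The list `rs` preceded by the face sums of ranks `l + n, …, l + 1`. -/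
def faceSums (rs : List (semigroupRing K S)) (l : ℕ) : ℕ → List (semigroupRing K S)
  | 0 => rs
  | n + 1 => faceSum K S F (l + n + 1) :: faceSums rs l n

lemma length_faceSums (rs : List (semigroupRing K S)) (l n : ℕ) :
    (faceSums F rs l n).length = rs.length + n := by
  induction n with
  | zero => rfl
  | succ n ih => rw [faceSums, List.length_cons, ih, add_assoc]

lemma mem_faceSums {rs : List (semigroupRing K S)} {l n : ℕ} {x : semigroupRing K S}
    (hx : x ∈ faceSums F rs l n) : x ∈ rs ∨ ∃ k, l < k ∧ x = faceSum K S F k := by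
  induction n with
  | zero => exact Or.inl hx
  | succ n ih =>
    rcases List.mem_cons.1 hx with rfl | hx
    · exact Or.inr ⟨_, by omega, rfl⟩
    · exact ih hx

theorem FiniteRegular.of_levelSet
    (hF : ∀ x ∈ AddSubgroup.closure (S : Set (Fin m → ℤ)), x ∈ S ↔ ∀ σ ∈ F, 0 ≤ lin σ x)
    {k : ℕ} (hk : 0 < k) (hkw : k • w ∈ AddSubgroup.closure (S : Set (Fin m → ℤ)))
    {l : ℕ} (e : Fin l → S) (he : ∀ i, -(e i : Fin m → ℤ) ∈ S)
    (hli : LinearIndependent ℤ fun i => (e i : Fin m → ℤ))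
    (hspan : Submodule.span ℤ (Set.range fun i => (e i : Fin m → ℤ)) = faceLattice S F)
    (n : ℕ) {J : Finset (Fin m → ℤ)} (hJ : IsFlat S F J)
    (hrk : Module.finrank ℤ (faceLattice S J) = l + n) {N : ℤ} (hN : 0 < N)
    {p : Fin m → ℤ} (hp : p ∈ AddSubgroup.closure (S : Set (Fin m → ℤ)))
    {Y Z : Set (Fin m → ℤ)} (hY : StableUnder S Y) (hZ : StableUnder S Z) (hZY : Z ⊆ Y)
    (hYZ : Y \ Z = levelSet S F w J N p) :
    FiniteRegular K (faceSums F (List.ofFn fun i => ringMono (e i) - 1) l n)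
      (monIdeal K S Y) (monIdeal K S Z) := by
  classical
  have hSF : ∀ x ∈ S, ∀ σ ∈ F, 0 ≤ lin σ x := fun x hx =>
    (hF x (AddSubgroup.subset_closure hx)).1 hx
  have hrkF : Module.finrank ℤ (faceLattice S F) = l := by
    rw [← hspan, finrank_span_eq_card hli, Fintype.card_fin]
  induction n generalizing J N p Y Z with
  | zero =>
    have hJF : J = F := by
      by_contra hne
      have := hJ.finrank_lt subset_rfl hJ.1 hne
      omega
    subst hJF
    refine FiniteRegular.of_units hY hZ hZY e he hli fun x hx y hy => ?_
    rw [hspan]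
    rw [hYZ] at hx hy
    exact sub_mem_faceLattice hN hx hy
  | succ n ih =>
    have hJF : J ≠ F := by
      rintro rfl
      omega
    obtain ⟨τ, hτF, hτJ⟩ := Finset.exists_of_ssubset (hJ.1.ssubset_of_ne hJF)
    have hτ : 1 ≤ lin τ (flatPoint S F J : Fin m → ℤ) := by
      have h1 := hSF _ (flatPoint S F J).2 τ hτF
      have h2 : lin τ (flatPoint S F J : Fin m → ℤ) ≠ 0 := fun h0 =>
        hτJ ((hJ.mem_iff hτF).2 h0)
      omega
    have hmove : ∀ s ∈ S, ∀ y ∈ Y, s + y ∉ Z → s ∈ faceLattice S J := by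
      intro s hs y hy hsy
      have h1 : s + y ∈ levelSet S F w J N p := hYZ ▸ ⟨hY s hs y hy, hsy⟩
      have h2 : y ∈ levelSet S F w J N p := hYZ ▸ ⟨hy, fun hyZ => hsy (hZ s hs y hyZ)⟩
      simpa using sub_mem_faceLattice hN h1 h2
    refine FiniteRegular.cons_of_acts_as_mono hY hZ (flatPoint S F J) _ ?_ ?_ ?_
      (FiniteRegular.of_slices hF hk hkw hJ hN hp hY hZ hZY hYZ ?_)
    · intro f hf
      rw [faceSum, ← Finset.add_sum_erase _ _ (Finset.mem_filter.2
        ⟨Finset.mem_powerset.2 hJ.1, hJ, hrk⟩), add_sub_cancel_left, Finset.sum_smul]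
      refine Submodule.sum_mem _ fun J' hJ' => ?_
      obtain ⟨hne, hmem⟩ := Finset.mem_erase.1 hJ'
      obtain ⟨-, hJ'f, hJ'r⟩ := Finset.mem_filter.1 hmem
      refine smul_mem_monIdeal_of_maps hY hZ _ (fun y hy => ?_) hf
      by_contra hyZ
      have h1 := hmove _ (flatPoint S F J').2 y hy hyZ
      have h2 : J ⊆ J' := fun σ hσ => (hJ'f.mem_iff (hJ.1 hσ)).2 (h1.2 σ hσ)
      have := hJ.finrank_lt hJ'f.1 h2 (Ne.symm hne)
      omega
    · intro x hx hvx
      by_contra hxZ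
      have h1 : x ∈ levelSet S F w J N p := hYZ ▸ ⟨hx, hxZ⟩
      have h2 := add_mem_levelSet hN hJ.flatPoint_mem (hSF _ (flatPoint S F J).2) h1
      rw [← hYZ] at h2
      exact h2.2 hvx
    · intro h x₀ hx₀
      by_contra hx₀Z
      have hall : ∀ j : ℕ, x₀ - j • (flatPoint S F J : Fin m → ℤ) ∈ Y \ Z := by
        intro j
        induction j with
        | zero => simpa using ⟨hx₀, hx₀Z⟩
        | succ j ihj =>
          have h1 := (h _ ihj.1).resolve_right ihj.2
          rw [sub_sub, ← succ_nsmul] at h1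
          refine ⟨h1, fun h2 => ihj.2 ?_⟩
          have h3 := hZ _ (flatPoint S F J).2 _ h2
          convert h3 using 1
          rw [succ_nsmul]
          abel
      set j : ℕ := (N * lin τ x₀ - lin τ p + 1).toNat with hj
      have h1 := hall j
      rw [hYZ] at h1
      have h2 := h1.2.2 τ hτF
      rw [lin_sub, lin_nsmul, mul_sub] at h2
      have h3 : N * lin τ x₀ - lin τ p + 1 ≤ j := Int.self_le_toNat _
      have h4 : (j : ℤ) * 1 ≤ j * lin τ (flatPoint S F J : Fin m → ℤ) :=
        mul_le_mul_of_nonneg_left hτ (Int.natCast_nonneg _)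
      have h5 : 1 * (j * lin τ (flatPoint S F J : Fin m → ℤ)) ≤
          N * (j * lin τ (flatPoint S F J : Fin m → ℤ)) :=
        mul_le_mul_of_nonneg_right hN (by
          have := Int.natCast_nonneg j
          linarith)
      linarith
    · intro J' hJ' hrk' N' hN' p' hp' Y' Z' hY' hZ' hZY' hYZ'
      exact ih hJ' (by omega) hN' hp' hY' hZ' hZY' hYZ'

end FaceSums

section Dimension

lemma ringKrullDim_le_of_trdeg_le (K R : Type*) [Field K] [CommRing R] [Nontrivial R] [Algebra K R]
    [Algebra.FiniteType K R] {d : ℕ} (h : Algebra.trdeg K R ≤ d) : ringKrullDim R ≤ d := by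
  obtain ⟨s, g, hinj, hint⟩ := exists_integral_inj_algHom_of_fg K R
  have hs : s ≤ d := by
    have h1 : AlgebraicIndependent K fun i : Fin s => g (MvPolynomial.X i) := by
      rw [algebraicIndependent_iff_injective_aeval]
      convert hinj
      ext i
      simp
    have h2 := h1.lift_cardinalMk_le_trdeg.trans (Cardinal.lift_le.2 h)
    simpa using h2
  have h3 : ringKrullDim (MvPolynomial (Fin s) K) = s := by
    rw [MvPolynomial.ringKrullDim_of_isNoetherianRing, ringKrullDim_eq_zero_of_field]
    simp
  refine le_trans (le_of_le_of_eq ?_ h3) (by exact_mod_cast hs)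
  algebraize [g.toRingHom]
  refine Order.krullDim_le_of_strictMono (PrimeSpectrum.comap g.toRingHom) fun p q hpq => ?_
  exact Ideal.IsIntegral.comap_lt_comap (R := MvPolynomial (Fin s) K) hpq

variable {K : Type*} [Field K] {m : ℕ} {S : AddSubmonoid (Fin m → ℤ)}

lemma mono_add (x y : Fin m → ℤ) : mono K (x + y) = mono K x * mono K y := by
  rw [mono, mono, mono, AddMonoidAlgebra.single_mul_single, one_mul]

lemma ringMono_add (x y : S) :
    (ringMono (x + y) : semigroupRing K S) = ringMono x * ringMono y :=
  Subtype.ext (mono_add _ _)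

lemma ringMono_zero : (ringMono 0 : semigroupRing K S) = 1 := rfl

lemma finiteType_semigroupRing (hS : S.FG) : Algebra.FiniteType K (semigroupRing K S) := by
  classical
  obtain ⟨T, hT⟩ := hS
  rw [← Subalgebra.fg_iff_finiteType]
  refine ⟨T.image (mono K), le_antisymm (Algebra.adjoin_mono ?_) (Algebra.adjoin_le ?_)⟩
  · rintro _ hf
    obtain ⟨x, hx, rfl⟩ := Finset.mem_image.1 hf
    exact ⟨x, hT ▸ AddSubmonoid.subset_closure hx, rfl⟩
  · rintro _ ⟨x, hx, rfl⟩
    rw [← hT] at hx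
    induction hx using AddSubmonoid.closure_induction with
    | mem x hx => exact Algebra.subset_adjoin (Finset.mem_image_of_mem _ hx)
    | zero => exact one_mem _
    | add x y _ _ hx hy =>
      rw [mono_add]
      exact mul_mem hx hy

lemma trdeg_semigroupRing_le (hneg : ∀ x ∈ S, -x ∈ S) {d : ℕ} (b : Fin d → S)
    (hb : ∀ x ∈ S, x ∈ AddSubgroup.closure (Set.range fun i => (b i : Fin m → ℤ))) :
    Algebra.trdeg K (semigroupRing K S) ≤ d := by
  set s : Set (semigroupRing K S) := Set.range fun i => ringMono (b i) with hs
  have hmem : ∀ x (hx : x ∈ S), IsAlgebraic (Algebra.adjoin K s)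
      (ringMono ⟨x, hx⟩ : semigroupRing K S) := by
    intro x hx
    suffices H : ∃ h : x ∈ S, IsAlgebraic (Algebra.adjoin K s)
      (ringMono ⟨x, h⟩ : semigroupRing K S) from H.2
    have hx' := hb x hx
    clear hx
    induction hx' using AddSubgroup.closure_induction with
    | mem x hx =>
      obtain ⟨i, rfl⟩ := hx
      exact ⟨(b i).2, isAlgebraic_algebraMap
        (⟨ringMono (b i), Algebra.subset_adjoin ⟨i, rfl⟩⟩ : Algebra.adjoin K s)⟩
    | zero => exact ⟨zero_mem _, isAlgebraic_one⟩
    | add x y _ _ hx hy =>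
      obtain ⟨hxS, hx⟩ := hx
      obtain ⟨hyS, hy⟩ := hy
      refine ⟨add_mem hxS hyS, ?_⟩
      have := hx.mul hy
      rwa [← ringMono_add] at this
    | neg x _ hx =>
      obtain ⟨hxS, hx⟩ := hx
      refine ⟨hneg x hxS, ?_⟩
      have hinv : (ringMono ⟨-x, hneg x hxS⟩ : semigroupRing K S) * ringMono ⟨x, hxS⟩ = 1 ∧
          (ringMono ⟨x, hxS⟩ : semigroupRing K S) * ringMono ⟨-x, hneg x hxS⟩ = 1 := by
        rw [← ringMono_add, ← ringMono_add, ← ringMono_zero]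
        constructor <;> congr 1 <;> ext <;> simp
      let _ : Invertible (ringMono ⟨x, hxS⟩ : semigroupRing K S) := ⟨_, hinv.1, hinv.2⟩
      exact hx.invOf
  have halg : Algebra.IsAlgebraic (Algebra.adjoin K s) (semigroupRing K S) := by
    refine ⟨fun ⟨f, hf⟩ => ?_⟩
    induction hf using Algebra.adjoin_induction with
    | mem f hf =>
      obtain ⟨x, hx, rfl⟩ := hf
      exact hmem x hx
    | algebraMap r =>
      have e : (⟨algebraMap K _ r, (semigroupRing K S).algebraMap_mem r⟩ : semigroupRing K S) =
          algebraMap (Algebra.adjoin K s) (semigroupRing K S) (algebraMap K _ r) := rfl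
      exact e ▸ isAlgebraic_algebraMap _
    | add f g hfS hgS hf hg =>
      have e : (⟨f + g, (semigroupRing K S).add_mem hfS hgS⟩ : semigroupRing K S) =
          ⟨f, hfS⟩ + ⟨g, hgS⟩ := Subtype.ext rfl
      exact (congrArg (IsAlgebraic (Algebra.adjoin K s)) e).mpr (hf.add hg)
    | mul f g hfS hgS hf hg =>
      have e : (⟨f * g, (semigroupRing K S).mul_mem hfS hgS⟩ : semigroupRing K S) =
          ⟨f, hfS⟩ * ⟨g, hgS⟩ := Subtype.ext rfl
      exact (congrArg (IsAlgebraic (Algebra.adjoin K s)) e).mpr (hf.mul hg)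
  refine (Algebra.IsAlgebraic.trdeg_le_cardinalMk K s).trans ?_
  have h1 := Cardinal.mk_range_le_lift (f := fun i => (ringMono (b i) : semigroupRing K S))
  rw [← hs] at h1
  simpa using h1

lemma ringKrullDim_semigroupRing_le (hS : S.FG) {d : ℕ} (b : Fin d → Fin m → ℤ)
    (hbS : ∀ i, b i ∈ AddSubgroup.closure (S : Set (Fin m → ℤ)))
    (hb : ∀ x ∈ S, x ∈ AddSubgroup.closure (Set.range b)) :
    ringKrullDim (semigroupRing K S) ≤ d := by
  have := finiteType_semigroupRing (K := K) hS
  refine ringKrullDim_le_of_trdeg_le K _ ?_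
  let G : AddSubmonoid (Fin m → ℤ) :=
    (AddSubgroup.closure (S : Set (Fin m → ℤ))).toAddSubmonoid
  have hle : semigroupRing K S ≤ semigroupRing K G :=
    Algebra.adjoin_mono fun f ⟨x, hx, e⟩ => ⟨x, AddSubgroup.subset_closure hx, e⟩
  refine (trdeg_le_of_injective (Subalgebra.inclusion hle)
    (Subalgebra.inclusion_injective hle)).trans ?_
  refine trdeg_semigroupRing_le (S := G)
    (fun x (hx : x ∈ AddSubgroup.closure (S : Set (Fin m → ℤ))) =>
      (neg_mem hx : -x ∈ AddSubgroup.closure (S : Set (Fin m → ℤ))))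
    (fun i => ⟨b i, hbS i⟩) fun x hx => ?_
  exact (AddSubgroup.closure_le _).2 hb hx

lemma length_le_supportDim_of_isRegular {R : Type*} [CommRing R] {M : Type*} [AddCommGroup M]
    [Module R M] [Module.Finite R M] {rs : List R} (h : RingTheory.Sequence.IsRegular M rs) :
    (rs.length : WithBot ℕ∞) ≤ Module.supportDim R M := by
  induction rs generalizing M with
  | nil =>
    have := h.nontrivial
    have h1 := (Module.supportDim_ne_bot_iff_nontrivial R M).2 this
    obtain ⟨a, ha⟩ := WithBot.ne_bot_iff_exists.1 h1
    rw [← ha]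
    exact WithBot.coe_le_coe.2 (by simp)
  | cons r rs ih =>
    rw [RingTheory.Sequence.isRegular_cons_iff] at h
    have h1 := ih h.2
    have h2 := Module.supportDim_quotSMulTop_succ_le_of_notMem_minimalPrimes (M := M) (x := r)
      fun p hp => h.1.notMem_of_mem_minimalPrimes hp
    refine le_trans ?_ h2
    rw [List.length_cons]
    push_cast
    gcongr

end Dimension

section CosetModules

variable {K : Type*} [Field K] {m : ℕ} {S : AddSubmonoid (Fin m → ℤ)}
  {F : Finset (Fin m → ℤ)} {w : Fin m → ℤ}

lemma Submodule.exists_linearIndependent_span_eq (L : Submodule ℤ (Fin m → ℤ)) :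
    ∃ b : Fin (Module.finrank ℤ L) → Fin m → ℤ,
      LinearIndependent ℤ b ∧ Submodule.span ℤ (Set.range b) = L := by
  refine ⟨L.subtype ∘ Module.finBasis ℤ L,
    (Module.finBasis ℤ L).linearIndependent.map' _ L.ker_subtype, ?_⟩
  rw [Set.range_comp, ← Submodule.map_span, (Module.finBasis ℤ L).span_eq, Submodule.map_top,
    L.range_subtype]

open Classical in
variable (S F) in
/-- The forms in `F` vanishing on all of `S`. -/
def trivialForms : Finset (Fin m → ℤ) := F.filter fun σ => ∀ x ∈ S, lin σ x = 0

lemma mem_trivialForms {σ : Fin m → ℤ} :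
    σ ∈ trivialForms S F ↔ σ ∈ F ∧ ∀ x ∈ S, lin σ x = 0 := by
  simp [trivialForms]

lemma faceLattice_trivialForms : faceLattice S (trivialForms S F) = faceLattice S ∅ := by
  refine le_antisymm (faceLattice_anti (Finset.empty_subset _)) fun x hx => ⟨hx.1, fun σ hσ => ?_⟩
  have h1 : AddSubgroup.closure (S : Set (Fin m → ℤ)) ≤ (linMap σ).toAddMonoidHom.ker :=
    (AddSubgroup.closure_le _).2 fun y hy => (mem_trivialForms.1 hσ).2 y hy
  exact h1 hx.1

lemma isFlat_trivialForms (hSF : ∀ x ∈ S, ∀ σ ∈ F, 0 ≤ lin σ x) :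
    IsFlat S F (trivialForms S F) := by
  have hex : ∀ σ : Fin m → ℤ, ∃ x ∈ S, (∃ y ∈ S, lin σ y ≠ 0) → lin σ x ≠ 0 := by
    intro σ
    by_cases h : ∃ y ∈ S, lin σ y ≠ 0
    · obtain ⟨y, hy, hne⟩ := h
      exact ⟨y, hy, fun _ => hne⟩
    · exact ⟨0, zero_mem _, fun h' => absurd h' h⟩
  choose x hxS hx using hex
  refine ⟨fun σ hσ => (mem_trivialForms.1 hσ).1,
    ⟨∑ σ ∈ F, x σ, sum_mem fun σ _ => hxS σ⟩, fun σ hσ => ?_⟩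
  rw [mem_trivialForms, and_iff_right hσ]
  constructor
  · intro h
    exact h _ (sum_mem fun σ _ => hxS σ)
  · intro h
    have h1 : ∑ τ ∈ F, lin σ (x τ) = 0 := by
      rw [← h]
      exact (map_sum (linMap σ) x F).symm
    have h2 := (Finset.sum_eq_zero_iff_of_nonneg fun τ _ => hSF _ (hxS τ) σ hσ).1 h1 σ hσ
    by_contra! hne
    exact hx σ hne h2

lemma ringMono_mem_irrelevantIdeal {x : S} (hx : (x : Fin m → ℤ) ≠ 0) :
    ringMono x ∈ irrelevantIdeal K S :=
  Ideal.subset_span ⟨x, x.2, hx, rfl⟩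

lemma ringMono_sub_one_mem_irrelevantIdeal {x : S} (hx : (x : Fin m → ℤ) ≠ 0)
    (hneg : -(x : Fin m → ℤ) ∈ S) : ringMono x - 1 ∈ irrelevantIdeal K S := by
  refine sub_mem (ringMono_mem_irrelevantIdeal hx) ?_
  have h1 := (irrelevantIdeal K S).mul_mem_left (ringMono ⟨_, hneg⟩)
    (ringMono_mem_irrelevantIdeal (K := K) hx)
  rw [← ringMono_add] at h1
  convert h1
  rw [← ringMono_zero]
  congr 1
  ext
  simp

lemma faceSum_mem_irrelevantIdeal {k : ℕ} (hk : Module.finrank ℤ (faceLattice S F) < k) :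
    faceSum K S F k ∈ irrelevantIdeal K S := by
  classical
  refine Ideal.sum_mem _ fun J hJ => ringMono_mem_irrelevantIdeal fun h0 => ?_
  obtain ⟨-, hJf, hJr⟩ := Finset.mem_filter.1 hJ
  have : J = F := hJf.1.antisymm fun σ hσ => (hJf.mem_iff hσ).2 (by rw [h0, lin_zero])
  subst this
  omega

variable (K) in
/-- One sequence is regular on all modules spanned by the points of a coset in the cone of `S`. -/
theorem exists_finiteRegular_sequence
    (hF : ∀ x ∈ AddSubgroup.closure (S : Set (Fin m → ℤ)), x ∈ S ↔ ∀ σ ∈ F, 0 ≤ lin σ x) :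
    ∃ rs : List (semigroupRing K S), rs.length = Module.finrank ℤ (faceLattice S ∅) ∧
      (∀ x ∈ rs, x ∈ irrelevantIdeal K S) ∧
      ∀ (w : Fin m → ℤ) (k : ℕ), 0 < k → k • w ∈ AddSubgroup.closure (S : Set (Fin m → ℤ)) →
        ∀ Y, StableUnder S Y → Y = levelSet S F w (trivialForms S F) 1 0 →
          FiniteRegular K rs (monIdeal K S Y) ⊥ := by
  have hSF : ∀ x ∈ S, ∀ σ ∈ F, 0 ≤ lin σ x := fun x hx =>
    (hF x (AddSubgroup.subset_closure hx)).1 hx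
  obtain ⟨b, hli, hspan⟩ := (faceLattice S F).exists_linearIndependent_span_eq
  have hFS : ∀ x ∈ faceLattice S F, x ∈ S := fun x hx =>
    (hF x hx.1).2 fun σ hσ => (hx.2 σ hσ).ge
  have hb : ∀ i, b i ∈ faceLattice S F := fun i =>
    hspan ▸ Submodule.subset_span (Set.mem_range_self i)
  have hneg : ∀ i, -b i ∈ S := fun i => hFS _ (neg_mem (hb i))
  have hle : Module.finrank ℤ (faceLattice S F) ≤ Module.finrank ℤ (faceLattice S ∅) :=
    Submodule.finrank_mono (faceLattice_anti (Finset.empty_subset _))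
  obtain ⟨n, hn⟩ := Nat.exists_eq_add_of_le hle
  let e : Fin (Module.finrank ℤ (faceLattice S F)) → S := fun i => ⟨b i, hFS _ (hb i)⟩
  refine ⟨faceSums F (List.ofFn fun i => ringMono (e i) - 1)
    (Module.finrank ℤ (faceLattice S F)) n, ?_, ?_, ?_⟩
  · rw [length_faceSums, List.length_ofFn, hn]
  · intro x hx
    rcases mem_faceSums hx with hx | ⟨k, hk, rfl⟩
    · obtain ⟨i, rfl⟩ := List.mem_ofFn.1 hx
      exact ringMono_sub_one_mem_irrelevantIdeal (hli.ne_zero i) (hneg i)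
    · exact faceSum_mem_irrelevantIdeal hk
  · intro w k hk hkw Y hY hYT
    rw [← monIdeal_empty]
    refine FiniteRegular.of_levelSet hF hk hkw e hneg hli hspan n (isFlat_trivialForms hSF)
      (by rw [faceLattice_trivialForms, hn]) one_pos (zero_mem _) hY (fun _ _ _ h => h)
      (Set.empty_subset _) ?_
    rw [Set.sdiff_empty, hYT]

/-- The points of a normal pure extension in a torsion coset are the points in the cone of `S`. -/
lemma coset_eq_levelSet {A : AddSubmonoid (Fin m → ℤ)} (hSA : S ≤ A)
    (hF : ∀ x ∈ AddSubgroup.closure (S : Set (Fin m → ℤ)), x ∈ S ↔ ∀ σ ∈ F, 0 ≤ lin σ x)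
    (hA : ∀ x : Fin m → ℤ, x ∈ AddSubgroup.closure (A : Set (Fin m → ℤ)) →
      ∀ k : ℕ, 0 < k → k • x ∈ A → x ∈ A)
    (hpure : ∀ a ∈ A, a ∈ AddSubgroup.closure (S : Set (Fin m → ℤ)) → a ∈ S)
    (hw : w ∈ AddSubgroup.closure (A : Set (Fin m → ℤ))) {k : ℕ} (hk : 0 < k)
    (hkw : k • w ∈ AddSubgroup.closure (S : Set (Fin m → ℤ))) :
    {a : Fin m → ℤ | a ∈ A ∧ a + w ∈ AddSubgroup.closure (S : Set (Fin m → ℤ))} =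
      levelSet S F w (trivialForms S F) 1 0 := by
  have hk' : (0 : ℤ) < k := by exact_mod_cast hk
  have hkx : ∀ x, x + w ∈ AddSubgroup.closure (S : Set (Fin m → ℤ)) →
      k • x ∈ AddSubgroup.closure (S : Set (Fin m → ℤ)) := fun x hx => by
    have := sub_mem (nsmul_mem hx k) hkw
    simpa [smul_add] using this
  ext x
  constructor
  · rintro ⟨hxA, hxw⟩
    have hS : k • x ∈ S := hpure _ (nsmul_mem hxA k) (hkx x hxw)
    refine ⟨hxw, fun σ hσ => ?_, fun σ hσ => ?_⟩
    · have h1 := (mem_trivialForms.1 hσ).2 _ hS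
      rw [lin_nsmul] at h1
      rw [lin_zero, one_mul]
      exact (mul_eq_zero.1 h1).resolve_left hk'.ne'
    · have h1 := (hF _ (hkx x hxw)).1 hS σ hσ
      rw [lin_nsmul] at h1
      rw [lin_zero, one_mul]
      exact nonneg_of_mul_nonneg_right h1 hk'
  · rintro ⟨hxw, -, hx⟩
    refine ⟨hA x ?_ k hk (hSA ((hF _ (hkx x hxw)).2 fun σ hσ => ?_)), hxw⟩
    · have h1 : AddSubgroup.closure (S : Set (Fin m → ℤ)) ≤ AddSubgroup.closure A :=
        AddSubgroup.closure_mono hSA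
      simpa using sub_mem (h1 hxw) hw
    · have h1 := hx σ hσ
      rw [lin_zero, one_mul] at h1
      rw [lin_nsmul]
      exact mul_nonneg hk'.le h1

lemma stableUnder_coset {A : AddSubmonoid (Fin m → ℤ)} (hSA : S ≤ A) : StableUnder S
    {a : Fin m → ℤ | a ∈ A ∧ a + w ∈ AddSubgroup.closure (S : Set (Fin m → ℤ))} := by
  rintro s hs x ⟨hx, hxw⟩
  refine ⟨add_mem (hSA hs) hx, ?_⟩
  rw [add_assoc]
  exact add_mem (AddSubgroup.subset_closure hs) hxw

lemma exists_nsmul_mem_closure {A : AddSubmonoid (Fin m → ℤ)}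
    (hw : w ∈ AddSubgroup.closure {z : Fin m → ℤ | z ∈ A ∧ ∃ k : ℕ, 0 < k ∧ k • z ∈ S}) :
    ∃ k : ℕ, 0 < k ∧ k • w ∈ AddSubgroup.closure (S : Set (Fin m → ℤ)) := by
  induction hw using AddSubgroup.closure_induction with
  | mem x hx =>
    obtain ⟨-, k, hk, hkx⟩ := hx
    exact ⟨k, hk, AddSubgroup.subset_closure hkx⟩
  | zero => exact ⟨1, one_pos, by simp⟩
  | add x y _ _ hx hy =>
    obtain ⟨k, hk, hkx⟩ := hx
    obtain ⟨l, hl, hly⟩ := hy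
    refine ⟨k * l, Nat.mul_pos hk hl, ?_⟩
    rw [smul_add, mul_smul, mul_smul, smul_comm k l x]
    exact add_mem (nsmul_mem hkx l) (nsmul_mem hly k)
  | neg x _ hx =>
    obtain ⟨k, hk, hkx⟩ := hx
    exact ⟨k, hk, by rw [smul_neg]; exact neg_mem hkx⟩

lemma monIdeal_self_finite : Module.Finite (semigroupRing K S) (monIdeal K S (S : Set _)) := by
  rw [Module.Finite.iff_fg]
  refine ⟨{1}, le_antisymm ?_ fun f hf => ?_⟩
  · rw [Submodule.span_le, Finset.coe_singleton, Set.singleton_subset_iff]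
    exact Submodule.subset_span ⟨0, zero_mem S, rfl⟩
  · rw [Finset.coe_singleton, Submodule.mem_span_singleton]
    rw [mem_monIdeal fun s hs y hy => S.add_mem hs hy] at hf
    exact ⟨⟨f, mem_semigroupRing.2 hf⟩, mul_one f⟩

lemma annihilator_eq_bot {N : Submodule (semigroupRing K S) (AddMonoidAlgebra K (Fin m → ℤ))}
    (hN : N ≠ ⊥) : Module.annihilator (semigroupRing K S) N = ⊥ := by
  obtain ⟨f, hf, hf0⟩ := N.ne_bot_iff.1 hN
  refine (Submodule.eq_bot_iff _).2 fun r hr => ?_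
  have h1 := congrArg Subtype.val (Module.mem_annihilator.1 hr ⟨f, hf⟩)
  exact Subtype.ext ((mul_eq_zero.1 (show (r : AddMonoidAlgebra K (Fin m → ℤ)) * f = 0 from
    h1)).resolve_right hf0)

variable (K) in
lemma ringKrullDim_semigroupRing (hS : S.FG)
    (hF : ∀ x ∈ AddSubgroup.closure (S : Set (Fin m → ℤ)), x ∈ S ↔ ∀ σ ∈ F, 0 ≤ lin σ x) :
    ringKrullDim (semigroupRing K S) = Module.finrank ℤ (faceLattice S ∅) := by
  apply le_antisymm
  · obtain ⟨b, -, hspan⟩ := (faceLattice S ∅).exists_linearIndependent_span_eq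
    refine ringKrullDim_semigroupRing_le hS b (fun i => ?_) fun x hx => ?_
    · have : b i ∈ faceLattice S ∅ := hspan ▸ Submodule.subset_span (Set.mem_range_self i)
      exact this.1
    · rw [← Submodule.span_int_eq_addSubgroupClosure, hspan]
      exact ⟨AddSubgroup.subset_closure hx, by simp⟩
  · obtain ⟨rs, hlen, -, hrs⟩ := exists_finiteRegular_sequence K hF
    have hcone : (S : Set (Fin m → ℤ)) = levelSet S F 0 (trivialForms S F) 1 0 := by
      have hSn : ∀ x ∈ AddSubgroup.closure (S : Set (Fin m → ℤ)), ∀ k : ℕ, 0 < k →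
          k • x ∈ S → x ∈ S := by
        intro x hx k hk hkx
        refine (hF x hx).2 fun σ hσ => ?_
        have h1 := (hF _ (AddSubgroup.subset_closure hkx)).1 hkx σ hσ
        rw [lin_nsmul] at h1
        exact nonneg_of_mul_nonneg_right h1 (by exact_mod_cast hk)
      rw [← coset_eq_levelSet le_rfl hF hSn (fun a ha _ => ha) (zero_mem _) one_pos (by simp)]
      ext x
      exact ⟨fun hx => ⟨hx, by rw [add_zero]; exact AddSubgroup.subset_closure hx⟩, fun hx => hx.1⟩
    have hreg := (hrs 0 1 one_pos (by simp) _ (fun s hs y hy => S.add_mem hs hy) hcone).isRegular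
      ((Submodule.ne_bot_iff _).2 ⟨1, Submodule.subset_span ⟨0, zero_mem S, rfl⟩, one_ne_zero⟩)
    have := monIdeal_self_finite (K := K) (S := S)
    rw [← hlen]
    exact (length_le_supportDim_of_isRegular hreg).trans (Module.supportDim_le_ringKrullDim _ _)

end CosetModules

/-- Theorem: coset modules of pure extensions are Cohen–Macaulay.
Let `S ⊆ A ⊆ ℤ^m` be normal affine semigroups with `S` pure in `A`
(`S = A ∩ gp(S)`), let `Ŝ = {z ∈ A : k•z ∈ S for some k ≥ 1}` be the integral closure of
`S` in `A`, and `R = K[S] ⊆ Q = K[A]`.  For every `w ∈ gp(Ŝ)`, the coset module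
`Q_w = K·{a ∈ A : a ≡ −w mod gp(S)}` is a Cohen–Macaulay `R`-module provided it is
nonzero. -/
theorem pure_extension_coset_module_isCM
    {m : ℕ} (K : Type*) [Field K]
    (S A : AddSubmonoid (Fin m → ℤ))
    (hSA : S ≤ A) (hSfg : S.FG) (hAfg : A.FG)
    (hSnormal : ∀ x : Fin m → ℤ, x ∈ AddSubgroup.closure (S : Set (Fin m → ℤ)) →
      ∀ k : ℕ, 0 < k → k • x ∈ S → x ∈ S)
    (hAnormal : ∀ x : Fin m → ℤ, x ∈ AddSubgroup.closure (A : Set (Fin m → ℤ)) →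
      ∀ k : ℕ, 0 < k → k • x ∈ A → x ∈ A)
    (hpure : ∀ a ∈ A, a ∈ AddSubgroup.closure (S : Set (Fin m → ℤ)) → a ∈ S)
    (w : Fin m → ℤ)
    (hw : w ∈ AddSubgroup.closure
      {z : Fin m → ℤ | z ∈ A ∧ ∃ k : ℕ, 0 < k ∧ k • z ∈ S})
    (hne : monIdeal K S
        {a : Fin m → ℤ | a ∈ A ∧ a + w ∈ AddSubgroup.closure (S : Set (Fin m → ℤ))} ≠ ⊥) :
    IsCohenMacaulayMod ↥(semigroupRing K S) (irrelevantIdeal K S)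
      ↥(monIdeal K S
        {a : Fin m → ℤ | a ∈ A ∧ a + w ∈ AddSubgroup.closure (S : Set (Fin m → ℤ))}) := by
  obtain ⟨F, hF⟩ := exists_forms_of_normal hSfg hSnormal
  obtain ⟨k, hk, hkw⟩ := exists_nsmul_mem_closure hw
  obtain ⟨rs, hlen, hmem, hrs⟩ := exists_finiteRegular_sequence K hF
  have hwA : w ∈ AddSubgroup.closure (A : Set (Fin m → ℤ)) :=
    AddSubgroup.closure_mono (fun _ hz => hz.1) hw
  have hreg := hrs w k hk hkw _ (stableUnder_coset hSA)
    (coset_eq_levelSet hSA hF hAnormal hpure hwA hk hkw)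
  refine ⟨rs, hmem, hreg.isRegular hne, fun y _ => hreg.not_isRegular_append y, ?_⟩
  rw [annihilator_eq_bot hne, ringKrullDim_eq_of_ringEquiv (RingEquiv.quotientBot _),
    ringKrullDim_semigroupRing K hSfg hF, hlen]
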